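/- arXiv:1612.01315 — 2 statements merged into one kernel-verified Lean document; each statement's English description precedes it below -/
import Mathlib

section
/- Let A be a rational map of degree at least two and O an orbifold on ℂP¹ such that the iterate A^{∘l} belongs to E(O) for some l ≥ 2. Then, unless the signature of O is {2,2}, {3,3}, {2,2,2}, or {2,2,4}, the map A itself belongs to E(O). -/
open Polynomial OnePoint
open scoped Classical

noncomputable section

namespace GenLattes

/-- Composition of rational functions: `rcomp f g = f ∘ g`. -/
def rcomp (f g : RatFunc ℂ) : RatFunc ℂ :=
  Polynomial.aeval g f.num / Polynomial.aeval g f.denom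

/-- The degree of a rational function: the maximum of the degrees of its numerator and
denominator in lowest terms. -/
def rdeg (f : RatFunc ℂ) : ℕ := max f.num.natDegree f.denom.natDegree

/-- Evaluation of a rational function at a finite point, with value in the Riemann
sphere `ℂP¹ = OnePoint ℂ`. -/
def evalF (f : RatFunc ℂ) (z : ℂ) : OnePoint ℂ :=
  if f.denom.eval z = 0 then ∞ else ((f.num.eval z / f.denom.eval z : ℂ) : OnePoint ℂ)

/-- The local degree (local multiplicity) of a rational function at a finite point. -/
def locDegF (f : RatFunc ℂ) (z : ℂ) : ℕ :=
  if f.denom.eval z = 0 then rootMultiplicity z f.denom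
  else rootMultiplicity z (f.num - Polynomial.C (f.num.eval z / f.denom.eval z) * f.denom)

/-- The rational function `f(1/X)`. -/
def flip (f : RatFunc ℂ) : RatFunc ℂ := rcomp f (RatFunc.X)⁻¹

/-- The self-map of the Riemann sphere `ℂP¹ = OnePoint ℂ` induced by a rational function. -/
def evalOP (f : RatFunc ℂ) (x : OnePoint ℂ) : OnePoint ℂ :=
  OnePoint.rec (evalF (flip f) 0) (fun z => evalF f z) x

/-- The local degree `deg_x f` of a rational function at a point of the Riemann sphere. -/
def locDeg (f : RatFunc ℂ) (x : OnePoint ℂ) : ℕ :=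
  OnePoint.rec (locDegF (flip f) 0) (fun z => locDegF f z) x

/-- The iterate `f^{∘l}` of a rational function (with `riter f 0 = X = id`). -/
def riter (f : RatFunc ℂ) : ℕ → RatFunc ℂ
  | 0 => RatFunc.X
  | l + 1 => rcomp f (riter f l)

/-- An orbifold on the Riemann sphere: a ramification function `ν : ℂP¹ → ℕ` with
`ν(z) ≥ 1` everywhere and `ν(z) = 1` outside a finite set. -/
structure Orbifold where
  nu : OnePoint ℂ → ℕ
  one_le : ∀ z, 1 ≤ nu z
  finite : {z : OnePoint ℂ | nu z ≠ 1}.Finite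

/-- A good orbifold: it is forbidden to have exactly one point with `ν > 1`, or exactly
two such points with different values of `ν`. -/
def Orbifold.Good (O : Orbifold) : Prop :=
  (¬ ∃ z, {w : OnePoint ℂ | O.nu w ≠ 1} = {z}) ∧
  (¬ ∃ z₁ z₂, z₁ ≠ z₂ ∧ {w : OnePoint ℂ | O.nu w ≠ 1} = {z₁, z₂} ∧ O.nu z₁ ≠ O.nu z₂)

/-- A nontrivial orbifold (distinct from the non-ramified sphere). -/
def Orbifold.IsNontrivial (O : Orbifold) : Prop := ∃ z, 1 < O.nu z

/-- The relation `O₁ ⪯ O₂`: pointwise divisibility of ramification functions. -/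
def Orbifold.Prec (O₁ O₂ : Orbifold) : Prop := ∀ z, O₁.nu z ∣ O₂.nu z

/-- The signature of an orbifold: the multiset of values of `ν` on `c(O) = {ν > 1}`. -/
def Orbifold.signature (O : Orbifold) : Multiset ℕ := O.finite.toFinset.val.map O.nu

/-- The Euler characteristic `χ(O) = 2 + Σ (1/ν(z) - 1)`. -/
def Orbifold.eulerChar (O : Orbifold) : ℚ :=
  2 + ∑ z ∈ O.finite.toFinset, ((O.nu z : ℚ)⁻¹ - 1)

/-- `A : O₁ → O₂` is a holomorphic map between orbifolds:
`ν₂(A(z)) ∣ ν₁(z)·deg_z A` for all `z`. -/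
def IsHolo (A : RatFunc ℂ) (O₁ O₂ : Orbifold) : Prop :=
  ∀ z, O₂.nu (evalOP A z) ∣ O₁.nu z * locDeg A z

/-- `A : O₁ → O₂` is a minimal holomorphic map between orbifolds:
`ν₂(A(z)) = ν₁(z)·gcd(deg_z A, ν₂(A(z)))` for all `z`. -/
def IsMinHolo (A : RatFunc ℂ) (O₁ O₂ : Orbifold) : Prop :=
  ∀ z, O₂.nu (evalOP A z) = O₁.nu z * Nat.gcd (locDeg A z) (O₂.nu (evalOP A z))

/-- `A : O₁ → O₂` is a covering map between orbifolds:
`ν₂(A(z)) = ν₁(z)·deg_z A` for all `z`. -/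
def IsCovering (A : RatFunc ℂ) (O₁ O₂ : Orbifold) : Prop :=
  ∀ z, O₂.nu (evalOP A z) = O₁.nu z * locDeg A z

/-- `A` and `B` are conjugate by a Möbius transformation: `A = μ ∘ B ∘ μ⁻¹`. -/
def Conjugate (A B : RatFunc ℂ) : Prop :=
  ∃ μ ν : RatFunc ℂ, rcomp μ ν = RatFunc.X ∧ rcomp ν μ = RatFunc.X ∧
    A = rcomp (rcomp μ B) ν

/-- The Chebyshev polynomial `T_d` viewed as a rational function. -/
def chebyRF (d : ℕ) : RatFunc ℂ :=
  algebraMap (Polynomial ℂ) (RatFunc ℂ) (Polynomial.Chebyshev.T ℂ d)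

end GenLattes

namespace GenLattes

/-! ### Composition as a field homomorphism -/

/-- Precomposition with a nonconstant rational function, as a homomorphism of fields. -/
def substHom (g : RatFunc ℂ) (hg : Transcendental ℂ g) : RatFunc ℂ →ₐ[ℂ] RatFunc ℂ :=
  (IntermediateField.val _).comp (RatFunc.algEquivOfTranscendental g hg).toAlgHom

theorem rcomp_eq_substHom (f : RatFunc ℂ) {g : RatFunc ℂ} (hg : Transcendental ℂ g) :
    rcomp f g = substHom g hg f := by
  simp [rcomp, substHom, RatFunc.algEquivOfTranscendental_apply]

theorem substHom_algebraMap {g : RatFunc ℂ} (hg : Transcendental ℂ g) (p : ℂ[X]) :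
    substHom g hg (algebraMap ℂ[X] (RatFunc ℂ) p) = aeval g p := by
  simp [substHom]

theorem substHom_X {g : RatFunc ℂ} (hg : Transcendental ℂ g) :
    substHom g hg RatFunc.X = g := by
  simp [substHom]

theorem substHom_C {g : RatFunc ℂ} (hg : Transcendental ℂ g) (c : ℂ) :
    substHom g hg (RatFunc.C c) = RatFunc.C c := by
  rw [← RatFunc.algebraMap_eq_C, AlgHom.commutes]

theorem transcendental_substHom {f g : RatFunc ℂ} (hf : Transcendental ℂ f)
    (hg : Transcendental ℂ g) : Transcendental ℂ (substHom g hg f) := by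
  rwa [Transcendental, isAlgebraic_algHom_iff _ (substHom g hg).injective]

theorem substHom_substHom {f g : RatFunc ℂ} (hf : Transcendental ℂ f)
    (hg : Transcendental ℂ g) (h : RatFunc ℂ) :
    substHom g hg (substHom f hf h) =
      substHom (substHom g hg f) (transcendental_substHom hf hg) h := by
  have key (p : ℂ[X]) : substHom g hg (aeval f p) = aeval (substHom g hg f) p :=
    (aeval_algHom_apply _ _ _).symm
  rw [← rcomp_eq_substHom h hf, ← rcomp_eq_substHom h, rcomp, rcomp, map_div₀, key, key]

theorem transcendental_X_inv : Transcendental ℂ (RatFunc.X : RatFunc ℂ)⁻¹ := by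
  rw [Transcendental, IsAlgebraic.inv_iff]
  exact RatFunc.transcendental_X

theorem flip_eq (f : RatFunc ℂ) : flip f = substHom _ transcendental_X_inv f :=
  rcomp_eq_substHom f _

theorem flip_flip (f : RatFunc ℂ) : flip (flip f) = f := by
  rw [flip_eq, flip_eq, substHom_substHom]
  have : substHom _ transcendental_X_inv (RatFunc.X : RatFunc ℂ)⁻¹ = RatFunc.X := by
    rw [map_inv₀, substHom_X, inv_inv]
  rw [← rcomp_eq_substHom, this, rcomp, RatFunc.aeval_X_left_eq_algebraMap,
    RatFunc.aeval_X_left_eq_algebraMap, RatFunc.num_div_denom]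

theorem transcendental_flip {f : RatFunc ℂ} (hf : Transcendental ℂ f) :
    Transcendental ℂ (flip f) := by
  rw [flip_eq]
  exact transcendental_substHom hf _

/-! ### Values at finite points -/

/-- The rational function `f` is regular at `a` with value `c`. -/
def HasVal (a : ℂ) (f : RatFunc ℂ) (c : ℂ) : Prop :=
  ∃ p q : ℂ[X], q.eval a ≠ 0 ∧ f = algebraMap _ _ p / algebraMap _ _ q ∧ c = p.eval a / q.eval a

theorem algebraMap_ne_zero_of_eval {a : ℂ} {q : ℂ[X]} (hq : q.eval a ≠ 0) :
    algebraMap ℂ[X] (RatFunc ℂ) q ≠ 0 :=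
  RatFunc.algebraMap_ne_zero fun h => hq (by simp [h])

theorem HasVal.add {a c d : ℂ} {f g : RatFunc ℂ} (hf : HasVal a f c) (hg : HasVal a g d) :
    HasVal a (f + g) (c + d) := by
  obtain ⟨p, q, hq, rfl, rfl⟩ := hf
  obtain ⟨r, s, hs, rfl, rfl⟩ := hg
  refine ⟨p * s + q * r, q * s, by simp [hq, hs], ?_, ?_⟩
  · rw [div_add_div _ _ (algebraMap_ne_zero_of_eval hq) (algebraMap_ne_zero_of_eval hs)]
    simp
  · rw [div_add_div _ _ hq hs]
    simp

theorem HasVal.mul {a c d : ℂ} {f g : RatFunc ℂ} (hf : HasVal a f c) (hg : HasVal a g d) :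
    HasVal a (f * g) (c * d) := by
  obtain ⟨p, q, hq, rfl, rfl⟩ := hf
  obtain ⟨r, s, hs, rfl, rfl⟩ := hg
  refine ⟨p * r, q * s, by simp [hq, hs], ?_, ?_⟩
  · rw [div_mul_div_comm]
    simp
  · rw [div_mul_div_comm]
    simp

theorem HasVal.inv {a c : ℂ} {f : RatFunc ℂ} (hf : HasVal a f c) (hc : c ≠ 0) :
    HasVal a f⁻¹ c⁻¹ := by
  obtain ⟨p, q, hq, rfl, rfl⟩ := hf
  refine ⟨q, p, fun h => hc (by simp [h]), by rw [inv_div], by rw [inv_div]⟩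

theorem HasVal.div {a c d : ℂ} {f g : RatFunc ℂ} (hf : HasVal a f c) (hg : HasVal a g d)
    (hd : d ≠ 0) : HasVal a (f / g) (c / d) := by
  rw [div_eq_mul_inv, div_eq_mul_inv]
  exact hf.mul (hg.inv hd)

theorem hasVal_algebraMap (a : ℂ) (p : ℂ[X]) :
    HasVal a (algebraMap _ _ p) (p.eval a) :=
  ⟨p, 1, by simp, by simp, by simp⟩

theorem hasVal_C (a c : ℂ) : HasVal a (RatFunc.C c) c := by
  simpa using hasVal_algebraMap a (C c)

theorem hasVal_one (a : ℂ) : HasVal a 1 1 := by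
  simpa using hasVal_C a 1

theorem HasVal.pow {a c : ℂ} {f : RatFunc ℂ} (hf : HasVal a f c) (n : ℕ) :
    HasVal a (f ^ n) (c ^ n) := by
  induction n with
  | zero => simpa using hasVal_one a
  | succ n ih =>
    rw [pow_succ, pow_succ]
    exact ih.mul hf

theorem HasVal.unique {a c d : ℂ} {f : RatFunc ℂ} (hf : HasVal a f c) (hg : HasVal a f d) :
    c = d := by
  obtain ⟨p, q, hq, rfl, rfl⟩ := hf
  obtain ⟨r, s, hs, h, rfl⟩ := hg
  rw [div_eq_div_iff (algebraMap_ne_zero_of_eval hq) (algebraMap_ne_zero_of_eval hs),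
    ← map_mul, ← map_mul] at h
  have h' := congrArg (eval a) (RatFunc.algebraMap_injective ℂ h)
  rw [div_eq_div_iff hq hs]
  simpa using h'

theorem HasVal.aeval {a c : ℂ} {g : RatFunc ℂ} (hg : HasVal a g c) (p : ℂ[X]) :
    HasVal a (aeval g p) (p.eval c) := by
  induction p using Polynomial.induction_on' with
  | add p q hp hq => simpa using hp.add hq
  | monomial n r =>
    rw [aeval_monomial, eval_monomial, RatFunc.algebraMap_eq_C]
    exact (hasVal_C a r).mul (hg.pow n)

theorem HasVal.substHom {a c d : ℂ} {g h : RatFunc ℂ} (hg : Transcendental ℂ g)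
    (hgc : HasVal a g c) (hh : HasVal c h d) : HasVal a (substHom g hg h) d := by
  obtain ⟨p, q, hq, rfl, rfl⟩ := hh
  rw [map_div₀, substHom_algebraMap, substHom_algebraMap]
  exact (hgc.aeval p).div (hgc.aeval q) hq

/-- A rational function is a unit at a point of the Riemann sphere if it has neither a zero nor
a pole there. -/
def UnitAt : OnePoint ℂ → RatFunc ℂ → Prop
  | ∞, h => ∃ c, c ≠ 0 ∧ HasVal 0 (flip h) c
  | (a : ℂ), h => ∃ c, c ≠ 0 ∧ HasVal a h c

/-- The standard local parameter of the Riemann sphere at a point, evaluated at `f`. -/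
def localParam : OnePoint ℂ → RatFunc ℂ → RatFunc ℂ
  | ∞, f => f⁻¹
  | (c : ℂ), f => f - RatFunc.C c

/-- The rational function `f` maps `z` to `w` with local degree `n ≥ 1`. -/
def HasLocDeg (f : RatFunc ℂ) (z w : OnePoint ℂ) (n : ℕ) : Prop :=
  1 ≤ n ∧ ∃ h, UnitAt z h ∧ localParam w f = localParam z RatFunc.X ^ n * h

theorem unitAt_infty (h : RatFunc ℂ) : UnitAt ∞ h ↔ UnitAt (0 : ℂ) (flip h) := Iff.rfl

theorem localParam_infty (f : RatFunc ℂ) : localParam ∞ f = f⁻¹ := rfl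

theorem localParam_coe (c : ℂ) (f : RatFunc ℂ) : localParam c f = f - RatFunc.C c := rfl

theorem substHom_localParam {g : RatFunc ℂ} (hg : Transcendental ℂ g) (w : OnePoint ℂ)
    (f : RatFunc ℂ) : substHom g hg (localParam w f) = localParam w (substHom g hg f) := by
  induction w with
  | infty => simp [localParam_infty]
  | coe c => simp [localParam_coe, substHom_C]

theorem flip_localParam (w : OnePoint ℂ) (f : RatFunc ℂ) :
    flip (localParam w f) = localParam w (flip f) := by
  simp only [flip_eq, substHom_localParam]

theorem flip_mul (f g : RatFunc ℂ) : flip (f * g) = flip f * flip g := by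
  simp only [flip_eq, map_mul]

theorem flip_pow (f : RatFunc ℂ) (n : ℕ) : flip (f ^ n) = flip f ^ n := by
  simp only [flip_eq, map_pow]

theorem flip_inv (f : RatFunc ℂ) : flip f⁻¹ = (flip f)⁻¹ := by
  simp only [flip_eq, map_inv₀]

theorem flip_X : flip RatFunc.X = RatFunc.X⁻¹ := by
  rw [flip_eq, substHom_X]

theorem hasLocDeg_infty {f : RatFunc ℂ} {w : OnePoint ℂ} {n : ℕ} :
    HasLocDeg f ∞ w n ↔ HasLocDeg (flip f) (0 : ℂ) w n := by
  unfold HasLocDeg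
  refine and_congr_right fun _ => ⟨?_, ?_⟩
  · rintro ⟨h, hu, he⟩
    refine ⟨flip h, hu, ?_⟩
    rw [← flip_localParam, he, flip_mul, flip_pow, localParam_infty, flip_inv, flip_X, inv_inv,
      localParam_coe]
    simp
  · rintro ⟨h, hu, he⟩
    refine ⟨flip h, by rwa [unitAt_infty, flip_flip], ?_⟩
    rw [← flip_flip (localParam w f), flip_localParam, he, flip_mul, flip_pow, localParam_infty,
      localParam_coe]
    simp [flip_X]

theorem hasVal_localParam_X (a : ℂ) : HasVal a (localParam a RatFunc.X) 0 := by
  have h := hasVal_algebraMap a (X - C a)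
  rwa [map_sub, RatFunc.algebraMap_X, RatFunc.algebraMap_C, eval_sub, eval_X, eval_C,
    sub_self] at h

theorem localParam_X_ne_zero (a : ℂ) : localParam a RatFunc.X ≠ 0 := by
  have h := RatFunc.algebraMap_ne_zero (X_sub_C_ne_zero a)
  rwa [map_sub, RatFunc.algebraMap_X, RatFunc.algebraMap_C] at h

theorem HasVal.localParam_of_hasLocDeg {f : RatFunc ℂ} {a : ℂ} {w : OnePoint ℂ} {n : ℕ}
    (h : HasLocDeg f a w n) : HasVal a (localParam w f) 0 := by
  obtain ⟨hn, u, ⟨c, hc, hu⟩, he⟩ := h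
  rw [he]
  simpa [show n ≠ 0 by omega] using ((hasVal_localParam_X a).pow n).mul hu


theorem ne_zero_of_transcendental {f : RatFunc ℂ} (hf : Transcendental ℂ f) : f ≠ 0 := by
  rintro rfl
  exact hf isAlgebraic_zero

theorem HasLocDeg.eq_of_le {f : RatFunc ℂ} {a : ℂ} {w : OnePoint ℂ} {n n' : ℕ}
    (h : HasLocDeg f a w n) (h' : HasLocDeg f a w n') (hle : n ≤ n') : n = n' := by
  obtain ⟨-, u, ⟨c, hc, hu⟩, he⟩ := h
  obtain ⟨-, u', ⟨c', hc', hu'⟩, he'⟩ := h'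
  obtain ⟨k, rfl⟩ := Nat.exists_eq_add_of_le hle
  rw [he, pow_add, mul_assoc] at he'
  have hk := mul_left_cancel₀ (pow_ne_zero n (localParam_X_ne_zero a)) he'
  by_contra hne
  have hv := ((hasVal_localParam_X a).pow k).mul hu'
  rw [← hk, zero_pow (by omega), zero_mul] at hv
  exact hc (hu.unique hv)

theorem HasLocDeg.unique_coe {f : RatFunc ℂ} (hf : Transcendental ℂ f) {a : ℂ}
    {w w' : OnePoint ℂ} {n n' : ℕ}
    (h : HasLocDeg f a w n) (h' : HasLocDeg f a w' n') : w = w' ∧ n = n' := by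
  have hw : w = w' := by
    have hv := HasVal.localParam_of_hasLocDeg h
    have hv' := HasVal.localParam_of_hasLocDeg h'
    have key (c : ℂ) (h1 : HasVal a (f - RatFunc.C c) 0) (h2 : HasVal a f⁻¹ 0) : False := by
      have hfc : HasVal a f c := by simpa using h1.add (hasVal_C a c)
      have h3 := hfc.mul h2
      rw [mul_inv_cancel₀ (ne_zero_of_transcendental hf), mul_zero] at h3
      exact zero_ne_one (h3.unique (hasVal_one a))
    induction w with
    | infty =>
      induction w' with
      | infty => rfl
      | coe c => exact (key c hv' hv).elim
    | coe c =>
      induction w' with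
      | infty => exact (key c hv hv').elim
      | coe d =>
        rw [localParam_coe] at hv hv'
        have h1 : HasVal a f c := by simpa using hv.add (hasVal_C a c)
        have h2 : HasVal a f d := by simpa using hv'.add (hasVal_C a d)
        rw [h1.unique h2]
  subst hw
  refine ⟨rfl, ?_⟩
  rcases le_total n n' with hle | hle
  · exact h.eq_of_le h' hle
  · exact (h'.eq_of_le h hle).symm

theorem HasLocDeg.unique {f : RatFunc ℂ} (hf : Transcendental ℂ f) {z w w' : OnePoint ℂ}
    {n n' : ℕ} (h : HasLocDeg f z w n) (h' : HasLocDeg f z w' n') : w = w' ∧ n = n' := by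
  induction z with
  | infty =>
    rw [hasLocDeg_infty] at h h'
    exact h.unique_coe (transcendental_flip hf) h'
  | coe a => exact h.unique_coe hf h'

theorem UnitAt.mul {z : OnePoint ℂ} {f g : RatFunc ℂ} (hf : UnitAt z f) (hg : UnitAt z g) :
    UnitAt z (f * g) := by
  induction z with
  | infty =>
    obtain ⟨c, hc, hf⟩ := hf
    obtain ⟨d, hd, hg⟩ := hg
    exact ⟨c * d, mul_ne_zero hc hd, by rw [flip_mul]; exact hf.mul hg⟩
  | coe a =>
    obtain ⟨c, hc, hf⟩ := hf
    obtain ⟨d, hd, hg⟩ := hg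
    exact ⟨c * d, mul_ne_zero hc hd, hf.mul hg⟩

theorem UnitAt.pow {z : OnePoint ℂ} {f : RatFunc ℂ} (hf : UnitAt z f) (n : ℕ) :
    UnitAt z (f ^ n) := by
  induction z with
  | infty =>
    obtain ⟨c, hc, hf⟩ := hf
    exact ⟨c ^ n, pow_ne_zero n hc, by rw [flip_pow]; exact hf.pow n⟩
  | coe a =>
    obtain ⟨c, hc, hf⟩ := hf
    exact ⟨c ^ n, pow_ne_zero n hc, hf.pow n⟩

theorem UnitAt.substHom_coe {a : ℂ} {w : OnePoint ℂ} {g h : RatFunc ℂ}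
    (hg : Transcendental ℂ g) (hgw : HasVal a (localParam w g) 0) (hh : UnitAt w h) :
    UnitAt a (substHom g hg h) := by
  induction w with
  | infty =>
    obtain ⟨c, hc, hh⟩ := hh
    refine ⟨c, hc, ?_⟩
    have h1 : Transcendental ℂ g⁻¹ := by rwa [Transcendental, IsAlgebraic.inv_iff]
    have h2 := HasVal.substHom h1 hgw hh
    have h3 : substHom g hg h = substHom g⁻¹ h1 (flip h) := by
      rw [flip_eq, substHom_substHom]
      have : substHom g⁻¹ h1 RatFunc.X⁻¹ = g := by rw [map_inv₀, substHom_X, inv_inv]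
      rw [← rcomp_eq_substHom, ← rcomp_eq_substHom, this]
    rwa [h3]
  | coe c =>
    obtain ⟨d, hd, hh⟩ := hh
    have h1 : HasVal a g c := by
      rw [localParam_coe] at hgw
      simpa using hgw.add (hasVal_C a c)
    exact ⟨d, hd, HasVal.substHom hg h1 hh⟩

theorem HasLocDeg.unitAt_substHom {z w : OnePoint ℂ} {g h : RatFunc ℂ} {n : ℕ}
    (hg : Transcendental ℂ g) (hgw : HasLocDeg g z w n) (hh : UnitAt w h) :
    UnitAt z (substHom g hg h) := by
  induction z with
  | infty =>
    rw [unitAt_infty, flip_eq, substHom_substHom]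
    rw [hasLocDeg_infty, flip_eq] at hgw
    exact UnitAt.substHom_coe _ (HasVal.localParam_of_hasLocDeg hgw) hh
  | coe a => exact UnitAt.substHom_coe _ (HasVal.localParam_of_hasLocDeg hgw) hh

/-- The chain rule for local degrees. -/
theorem HasLocDeg.comp {f g : RatFunc ℂ} (hg : Transcendental ℂ g) {z w v : OnePoint ℂ}
    {n m : ℕ} (hfw : HasLocDeg f w v n) (hgz : HasLocDeg g z w m) :
    HasLocDeg (substHom g hg f) z v (m * n) := by
  obtain ⟨hn, h, hh, hf⟩ := hfw
  have hu := hgz.unitAt_substHom hg hh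
  obtain ⟨hm, k, hk, hgk⟩ := hgz
  refine ⟨Nat.mul_pos hm hn, k ^ n * substHom g hg h, (hk.pow n).mul hu, ?_⟩
  rw [← substHom_localParam, hf, map_mul, map_pow, substHom_localParam, substHom_X, hgk]
  ring

/-! ### Fibers -/

/-- The polynomial whose finite roots are the finite points mapped to `w` by `f`. -/
def fiberPoly (f : RatFunc ℂ) : OnePoint ℂ → ℂ[X]
  | ∞ => f.denom
  | (c : ℂ) => f.num - C c * f.denom

/-- The polynomial by which `fiberPoly f w` is divided in the local parameter at `w`. -/
def fiberDenom (f : RatFunc ℂ) : OnePoint ℂ → ℂ[X]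
  | ∞ => f.num
  | (_ : ℂ) => f.denom

theorem fiberPoly_infty (f : RatFunc ℂ) : fiberPoly f ∞ = f.denom := rfl

theorem fiberPoly_coe (f : RatFunc ℂ) (c : ℂ) : fiberPoly f c = f.num - C c * f.denom := rfl

theorem fiberDenom_infty (f : RatFunc ℂ) : fiberDenom f ∞ = f.num := rfl

theorem fiberDenom_coe (f : RatFunc ℂ) (c : ℂ) : fiberDenom f c = f.denom := rfl

theorem localParam_eq_div (f : RatFunc ℂ) (w : OnePoint ℂ) :
    localParam w f = algebraMap _ _ (fiberPoly f w) / algebraMap _ _ (fiberDenom f w) := by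
  induction w with
  | infty =>
    rw [localParam_infty, fiberPoly_infty, fiberDenom_infty]
    conv_lhs => rw [← RatFunc.num_div_denom f]
    rw [inv_div]
  | coe c =>
    rw [localParam_coe, fiberPoly_coe, fiberDenom_coe]
    conv_lhs => rw [← RatFunc.num_div_denom f]
    have := RatFunc.algebraMap_ne_zero (RatFunc.denom_ne_zero f)
    rw [map_sub, map_mul, RatFunc.algebraMap_C]
    field_simp

theorem isCoprime_fiberPoly (f : RatFunc ℂ) (w : OnePoint ℂ) :
    IsCoprime (fiberPoly f w) (fiberDenom f w) := by
  induction w with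
  | infty => exact (RatFunc.isCoprime_num_denom f).symm
  | coe c =>
    rw [fiberPoly_coe, fiberDenom_coe, sub_eq_add_neg, ← neg_mul]
    exact (RatFunc.isCoprime_num_denom f).add_mul_right_left _

theorem transcendental_iff_rdeg {f : RatFunc ℂ} : Transcendental ℂ f ↔ 1 ≤ rdeg f := by
  constructor
  · intro hf
    by_contra h
    have h0 : max f.num.natDegree f.denom.natDegree = 0 := by unfold rdeg at h; omega
    have h1 := eq_C_of_natDegree_eq_zero (Nat.max_eq_zero_iff.mp h0).1
    have h2 := eq_C_of_natDegree_eq_zero (Nat.max_eq_zero_iff.mp h0).2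
    apply hf
    rw [← RatFunc.num_div_denom f, h1, h2, RatFunc.algebraMap_C, RatFunc.algebraMap_C, ← map_div₀,
      ← RatFunc.algebraMap_eq_C]
    exact isAlgebraic_algebraMap _
  · intro hf
    refine RatFunc.transcendental_of_ne_C _ ?_
    rintro ⟨c, rfl⟩
    simp [rdeg] at hf

theorem fiberPoly_ne_zero {f : RatFunc ℂ} (hf : Transcendental ℂ f) (w : OnePoint ℂ) :
    fiberPoly f w ≠ 0 := by
  induction w with
  | infty => exact RatFunc.denom_ne_zero f
  | coe c =>
    intro h
    have h1 := localParam_eq_div f c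
    rw [h, map_zero, zero_div, localParam_coe, sub_eq_zero] at h1
    apply hf
    rw [h1, ← RatFunc.algebraMap_eq_C]
    exact isAlgebraic_algebraMap _

theorem fiberDenom_ne_zero {f : RatFunc ℂ} (hf : Transcendental ℂ f) (w : OnePoint ℂ) :
    fiberDenom f w ≠ 0 := by
  induction w with
  | infty => exact RatFunc.num_ne_zero (ne_zero_of_transcendental hf)
  | coe c => exact RatFunc.denom_ne_zero f

theorem hasLocDeg_of_isRoot {f : RatFunc ℂ} (hf : Transcendental ℂ f) {w : OnePoint ℂ} {a : ℂ}
    (ha : (fiberPoly f w).eval a = 0) :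
    HasLocDeg f a w (rootMultiplicity a (fiberPoly f w)) := by
  have hN := fiberPoly_ne_zero hf w
  refine ⟨(rootMultiplicity_pos hN).mpr ha, ?_⟩
  obtain ⟨q, hq, hqa⟩ := exists_eq_pow_rootMultiplicity_mul_and_not_dvd _ hN a
  have hD : (fiberDenom f w).eval a ≠ 0 := by
    intro h
    obtain ⟨u, v, huv⟩ := isCoprime_fiberPoly f w
    have := congrArg (eval a) huv
    simp [ha, h] at this
  refine ⟨algebraMap _ _ q / algebraMap _ _ (fiberDenom f w), ?_, ?_⟩
  · refine ⟨q.eval a / (fiberDenom f w).eval a, div_ne_zero ?_ hD, _, _, hD, rfl, rfl⟩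
    rwa [dvd_iff_isRoot, IsRoot.def] at hqa
  · rw [localParam_eq_div]
    conv_lhs => rw [hq]
    rw [map_mul, map_pow, map_sub, RatFunc.algebraMap_X, RatFunc.algebraMap_C, localParam_coe,
      mul_div_assoc]

theorem evalF_eq_iff {f : RatFunc ℂ} {a : ℂ} {w : OnePoint ℂ} :
    evalF f a = w ↔ (fiberPoly f w).eval a = 0 := by
  have hcop : f.denom.eval a = 0 → f.num.eval a ≠ 0 := by
    intro h h'
    obtain ⟨u, v, huv⟩ := RatFunc.isCoprime_num_denom f
    have := congrArg (eval a) huv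
    simp [h, h'] at this
  unfold evalF
  induction w with
  | infty => simp [fiberPoly_infty]
  | coe c =>
    rw [fiberPoly_coe]
    split_ifs with h
    · simp [h, hcop h]
    · rw [OnePoint.coe_eq_coe, div_eq_iff h]
      simp [sub_eq_zero]

theorem locDegF_eq (f : RatFunc ℂ) (a : ℂ) :
    locDegF f a = rootMultiplicity a (fiberPoly f (evalF f a)) := by
  unfold locDegF evalF
  split_ifs with h
  · rfl
  · rfl

theorem hasLocDeg_evalF {f : RatFunc ℂ} (hf : Transcendental ℂ f) (a : ℂ) :
    HasLocDeg f a (evalF f a) (locDegF f a) := by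
  rw [locDegF_eq]
  exact hasLocDeg_of_isRoot hf (evalF_eq_iff.mp rfl)

theorem hasLocDeg_evalOP {f : RatFunc ℂ} (hf : Transcendental ℂ f) (z : OnePoint ℂ) :
    HasLocDeg f z (evalOP f z) (locDeg f z) := by
  induction z with
  | infty =>
    rw [hasLocDeg_infty]
    exact hasLocDeg_evalF (transcendental_flip hf) 0
  | coe a => exact hasLocDeg_evalF hf a

theorem evalOP_rcomp {f g : RatFunc ℂ} (hf : Transcendental ℂ f) (hg : Transcendental ℂ g)
    (z : OnePoint ℂ) : evalOP (rcomp f g) z = evalOP f (evalOP g z) := by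
  rw [rcomp_eq_substHom f hg]
  exact ((hasLocDeg_evalOP (transcendental_substHom hf hg) z).unique
    (transcendental_substHom hf hg)
    ((hasLocDeg_evalOP hf _).comp hg (hasLocDeg_evalOP hg z))).1

theorem locDeg_rcomp {f g : RatFunc ℂ} (hf : Transcendental ℂ f) (hg : Transcendental ℂ g)
    (z : OnePoint ℂ) :
    locDeg (rcomp f g) z = locDeg g z * locDeg f (evalOP g z) := by
  rw [rcomp_eq_substHom f hg]
  exact ((hasLocDeg_evalOP (transcendental_substHom hf hg) z).unique
    (transcendental_substHom hf hg)
    ((hasLocDeg_evalOP hf _).comp hg (hasLocDeg_evalOP hg z))).2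

theorem flip_algebraMap_mul_X_pow (p : ℂ[X]) :
    flip (algebraMap _ _ p) * RatFunc.X ^ p.natDegree = algebraMap _ _ p.reverse := by
  have hX : (RatFunc.X : RatFunc ℂ) ≠ 0 := RatFunc.X_ne_zero
  let _ := invertibleOfNonzero (inv_ne_zero hX)
  have h := eval₂_reverse_mul_pow (algebraMap ℂ (RatFunc ℂ)) (RatFunc.X : RatFunc ℂ)⁻¹ p
  rw [invOf_eq_inv, inv_inv] at h
  rw [flip_eq, substHom_algebraMap, aeval_def, ← h, mul_assoc, ← mul_pow, inv_mul_cancel₀ hX,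
    one_pow, mul_one, ← aeval_def, RatFunc.aeval_X_left_eq_algebraMap]

theorem unitAt_infty_div {p q : ℂ[X]} (hp : p ≠ 0) (hq : q ≠ 0)
    (hpq : p.natDegree = q.natDegree) :
    UnitAt ∞ (algebraMap _ _ p / algebraMap _ _ q : RatFunc ℂ) := by
  have hX : (RatFunc.X : RatFunc ℂ) ^ q.natDegree ≠ 0 := pow_ne_zero _ RatFunc.X_ne_zero
  have h0 {r : ℂ[X]} (hr : r ≠ 0) : r.reverse.eval 0 ≠ 0 := by
    rw [← coeff_zero_eq_eval_zero, coeff_zero_reverse]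
    simpa using hr
  refine ⟨_, div_ne_zero (h0 hp) (h0 hq), p.reverse, q.reverse, h0 hq, ?_, rfl⟩
  rw [← flip_algebraMap_mul_X_pow, ← flip_algebraMap_mul_X_pow, hpq, mul_div_mul_right _ _ hX,
    flip_eq, flip_eq, flip_eq, map_div₀]

theorem natDegree_fiberPoly_le (f : RatFunc ℂ) (w : OnePoint ℂ) :
    (fiberPoly f w).natDegree ≤ rdeg f := by
  induction w with
  | infty => exact le_max_right _ _
  | coe c =>
    refine (natDegree_sub_le _ _).trans (max_le (le_max_left _ _) ?_)
    exact (natDegree_C_mul_le _ _).trans (le_max_right _ _)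

theorem natDegree_fiberDenom {f : RatFunc ℂ} {w : OnePoint ℂ}
    (h : (fiberPoly f w).natDegree < rdeg f) : (fiberDenom f w).natDegree = rdeg f := by
  induction w with
  | infty =>
    rw [fiberPoly_infty] at h
    rw [fiberDenom_infty]
    unfold rdeg at h ⊢
    omega
  | coe c =>
    rw [fiberPoly_coe] at h
    rw [fiberDenom_coe]
    unfold rdeg at h ⊢
    by_contra hne
    have hlt : f.denom.natDegree < f.num.natDegree := by omega
    rw [natDegree_sub_eq_left_of_natDegree_lt ((natDegree_C_mul_le _ _).trans_lt hlt)] at h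
    omega

theorem hasLocDeg_infty_of_natDegree_lt {f : RatFunc ℂ} (hf : Transcendental ℂ f)
    {w : OnePoint ℂ} (h : (fiberPoly f w).natDegree < rdeg f) :
    HasLocDeg f ∞ w (rdeg f - (fiberPoly f w).natDegree) := by
  have hN := fiberPoly_ne_zero hf w
  refine ⟨by omega, algebraMap _ _ (X ^ (rdeg f - (fiberPoly f w).natDegree) * fiberPoly f w) /
    algebraMap _ _ (fiberDenom f w), unitAt_infty_div ?_ (fiberDenom_ne_zero hf w) ?_, ?_⟩
  · exact mul_ne_zero (pow_ne_zero _ X_ne_zero) hN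
  · rw [natDegree_fiberDenom h, natDegree_X_pow_mul _ hN]
    omega
  · have hX : (RatFunc.X : RatFunc ℂ) ≠ 0 := RatFunc.X_ne_zero
    rw [localParam_eq_div, map_mul, map_pow, RatFunc.algebraMap_X, localParam_infty, mul_div_assoc,
      ← mul_assoc, ← mul_pow, inv_mul_cancel₀ hX, one_pow, one_mul]

theorem exists_natDegree_fiberPoly_lt {f : RatFunc ℂ} (hf : Transcendental ℂ f) :
    ∃ w, (fiberPoly f w).natDegree < rdeg f := by
  have hd := transcendental_iff_rdeg.mp hf
  by_cases h : f.denom.natDegree < rdeg f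
  · exact ⟨∞, h⟩
  have hle : f.num.natDegree ≤ rdeg f := le_max_left _ _
  have hle' : f.denom.natDegree ≤ rdeg f := le_max_right _ _
  have hq : f.denom.coeff (rdeg f) = 1 := by
    rw [show rdeg f = f.denom.natDegree by omega]
    exact RatFunc.monic_denom f
  refine ⟨((f.num.coeff (rdeg f) : ℂ) : OnePoint ℂ), ?_⟩
  refine lt_of_le_of_ne (natDegree_fiberPoly_le f _) fun heq => ?_
  have hlc : (fiberPoly f ((f.num.coeff (rdeg f) : ℂ) : OnePoint ℂ)).coeff (rdeg f) = 0 := by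
    rw [fiberPoly_coe, coeff_sub, coeff_C_mul, hq, mul_one, sub_self]
  have h0 := leadingCoeff_ne_zero.mpr
    (fiberPoly_ne_zero hf ((f.num.coeff (rdeg f) : ℂ) : OnePoint ℂ))
  rw [leadingCoeff, heq] at h0
  exact h0 hlc

theorem evalOP_infty_eq_iff {f : RatFunc ℂ} (hf : Transcendental ℂ f) {w : OnePoint ℂ} :
    evalOP f ∞ = w ↔ (fiberPoly f w).natDegree < rdeg f := by
  have key {v : OnePoint ℂ} (h : (fiberPoly f v).natDegree < rdeg f) : evalOP f ∞ = v :=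
    ((hasLocDeg_evalOP hf ∞).unique hf (hasLocDeg_infty_of_natDegree_lt hf h)).1
  refine ⟨?_, key⟩
  rintro rfl
  obtain ⟨v, hv⟩ := exists_natDegree_fiberPoly_lt hf
  rwa [key hv]

theorem locDeg_infty {f : RatFunc ℂ} (hf : Transcendental ℂ f) :
    locDeg f ∞ = rdeg f - (fiberPoly f (evalOP f ∞)).natDegree :=
  ((hasLocDeg_evalOP hf ∞).unique hf
    (hasLocDeg_infty_of_natDegree_lt hf ((evalOP_infty_eq_iff hf).mp rfl))).2

theorem locDeg_pos {f : RatFunc ℂ} (hf : Transcendental ℂ f) (z : OnePoint ℂ) :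
    0 < locDeg f z :=
  (hasLocDeg_evalOP hf z).1

/-- The inclusion of the finite plane in the Riemann sphere, as an embedding. -/
def coeEmb : ℂ ↪ OnePoint ℂ := ⟨(↑), OnePoint.coe_injective⟩

@[simp]
theorem coeEmb_apply (a : ℂ) : coeEmb a = (a : OnePoint ℂ) := rfl

/-- The preimages of `w` under `f`, as a finite set. -/
def fiber (f : RatFunc ℂ) (w : OnePoint ℂ) : Finset (OnePoint ℂ) :=
  (fiberPoly f w).roots.toFinset.map coeEmb ∪ if evalOP f ∞ = w then {∞} else ∅

theorem mem_fiber {f : RatFunc ℂ} (hf : Transcendental ℂ f) {w z : OnePoint ℂ} :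
    z ∈ fiber f w ↔ evalOP f z = w := by
  unfold fiber
  induction z with
  | infty => split_ifs with h <;> simp [h]
  | coe a =>
    have : evalOP f a = w ↔ (fiberPoly f w).eval a = 0 := evalF_eq_iff
    rw [this]
    split_ifs with h <;> simp [fiberPoly_ne_zero hf w]

theorem sum_locDeg_fiber {f : RatFunc ℂ} (hf : Transcendental ℂ f) (w : OnePoint ℂ) :
    ∑ z ∈ fiber f w, locDeg f z = rdeg f := by
  have h1 : ∑ a ∈ (fiberPoly f w).roots.toFinset, locDeg f a = (fiberPoly f w).natDegree := by
    rw [← IsAlgClosed.card_roots_eq_natDegree, ← Multiset.toFinset_sum_count_eq]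
    refine Finset.sum_congr rfl fun a ha => ?_
    have haw : evalF f a = w := by
      rw [evalF_eq_iff]
      exact (mem_roots'.mp (Multiset.mem_toFinset.mp ha)).2
    rw [count_roots, ← haw]
    exact locDegF_eq f a
  have hle := natDegree_fiberPoly_le f w
  unfold fiber
  rw [Finset.sum_union, Finset.sum_map]
  · have h1' : ∑ a ∈ (fiberPoly f w).roots.toFinset, locDeg f (coeEmb a) =
        (fiberPoly f w).natDegree := h1
    rw [h1']
    split_ifs with h
    · rw [Finset.sum_singleton, locDeg_infty hf, h]
      omega
    · rw [evalOP_infty_eq_iff hf] at h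
      simp
      omega
  · split_ifs with h <;> simp

theorem wronskian_fiberPoly (f : RatFunc ℂ) (w : OnePoint ℂ) :
    Associated (wronskian (fiberPoly f w) (fiberDenom f w)) (wronskian f.num f.denom) := by
  induction w with
  | infty =>
    rw [fiberPoly_infty, fiberDenom_infty, ← wronskian_neg_eq]
    exact (Associated.refl _).neg_left
  | coe c =>
    have : wronskian (fiberPoly f c) (fiberDenom f c) = wronskian f.num f.denom := by
      rw [fiberPoly_coe, fiberDenom_coe]
      simp only [wronskian, derivative_sub, derivative_C_mul]
      ring
    rw [this]

theorem wronskian_ne_zero {f : RatFunc ℂ} (hf : Transcendental ℂ f) :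
    wronskian f.num f.denom ≠ 0 := by
  intro h
  rw [(RatFunc.isCoprime_num_denom f).wronskian_eq_zero_iff] at h
  have h1 := derivative_eq_zero.mp h.1
  have h2 := derivative_eq_zero.mp h.2
  have := transcendental_iff_rdeg.mp hf
  simp [rdeg, h1, h2] at this

theorem locDeg_coe_le {f : RatFunc ℂ} (hf : Transcendental ℂ f) (a : ℂ) :
    locDeg f a - 1 ≤ rootMultiplicity a (wronskian f.num f.denom) := by
  have hl : locDeg f a = rootMultiplicity a (fiberPoly f (evalF f a)) := locDegF_eq f a
  rw [le_rootMultiplicity_iff (wronskian_ne_zero hf), hl]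
  set w := evalF f a
  have hdvd := pow_rootMultiplicity_dvd (fiberPoly f w) a
  refine Dvd.dvd.trans ?_ (wronskian_fiberPoly f w).dvd
  refine dvd_sub ?_ ?_
  · exact ((pow_dvd_pow _ (Nat.sub_le _ _)).trans hdvd).mul_right _
  · exact (pow_sub_one_dvd_derivative_of_pow_dvd hdvd).mul_right _

theorem natDegree_wronskian_add_le {f : RatFunc ℂ} (hf : Transcendental ℂ f) :
    (wronskian f.num f.denom).natDegree + (locDeg f ∞ - 1) ≤ 2 * rdeg f - 2 := by
  have hlt := (evalOP_infty_eq_iff hf).mp rfl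
  rw [locDeg_infty hf]
  set w := evalOP f ∞
  have hass := wronskian_fiberPoly f w
  have h0 : wronskian (fiberPoly f w) (fiberDenom f w) ≠ 0 :=
    hass.ne_zero_iff.mpr (wronskian_ne_zero hf)
  have h1 := natDegree_wronskian_lt_add h0
  rw [natDegree_eq_of_degree_eq (degree_eq_degree_of_associated hass),
    natDegree_fiberDenom hlt] at h1
  omega

/-- An inequality in the Riemann–Hurwitz formula. -/
theorem sum_locDeg_sub_one_le {f : RatFunc ℂ} (hf : Transcendental ℂ f)
    (T : Finset (OnePoint ℂ)) : ∑ z ∈ T, (locDeg f z - 1) ≤ 2 * rdeg f - 2 := by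
  set W := wronskian f.num f.denom
  have h1 (U : Finset ℂ) : ∑ a ∈ U, (locDeg f a - 1) ≤ W.natDegree := by
    refine le_trans (Finset.sum_le_sum fun a _ => locDeg_coe_le hf a) ?_
    refine le_trans (Finset.sum_le_sum_of_subset
      (Finset.subset_union_left (s₂ := W.roots.toFinset))) ?_
    rw [← IsAlgClosed.card_roots_eq_natDegree]
    refine le_of_eq ?_
    rw [← Multiset.sum_count_eq_card (s := U ∪ W.roots.toFinset)]
    · exact Finset.sum_congr rfl fun a _ => (count_roots W).symm
    · intro a ha
      exact Finset.mem_union_right _ (Multiset.mem_toFinset.mpr ha)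
  have hT : T ⊆ insert ∞ ((T.preimage _ OnePoint.coe_injective.injOn).map
      coeEmb) := by
    intro z hz
    induction z with
    | infty => simp
    | coe a => simpa using hz
  refine (Finset.sum_le_sum_of_subset hT).trans ?_
  rw [Finset.sum_insert (by simp), Finset.sum_map]
  have h2 : ∑ a ∈ T.preimage _ OnePoint.coe_injective.injOn,
      (locDeg f (coeEmb a) - 1) ≤ W.natDegree := h1 _
  have h3 : W.natDegree + (locDeg f ∞ - 1) ≤ 2 * rdeg f - 2 := natDegree_wronskian_add_le hf
  omega

/-! ### Pullback of ramification functions -/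

/-- The ramification index of the pullback, under a map of local degree `m`, of a point of
ramification index `n`. -/
def reduce (m n : ℕ) : ℕ := n / Nat.gcd m n

theorem reduce_mul_gcd (m n : ℕ) : reduce m n * Nat.gcd m n = n :=
  Nat.div_mul_cancel (Nat.gcd_dvd_right m n)

theorem mul_reduce (m n : ℕ) : m * reduce m n = Nat.lcm m n := by
  rw [reduce, Nat.lcm, Nat.mul_div_assoc _ (Nat.gcd_dvd_right m n)]

theorem reduce_dvd (m n : ℕ) : reduce m n ∣ n :=
  Nat.div_dvd_of_dvd (Nat.gcd_dvd_right m n)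

theorem reduce_pos {m n : ℕ} (hn : 0 < n) : 0 < reduce m n :=
  Nat.pos_of_dvd_of_pos (reduce_dvd m n) hn

theorem reduce_one_left (n : ℕ) : reduce 1 n = n := by simp [reduce]

theorem reduce_one_right (m : ℕ) : reduce m 1 = 1 := by simp [reduce]

theorem reduce_reduce (k n : ℕ) {m : ℕ} (hm : 0 < m) :
    reduce k (reduce m n) = reduce (m * k) n := by
  obtain ⟨m', n', hcop, hm', hn'⟩ := Nat.exists_coprime m n
  have hg : 0 < Nat.gcd m n := Nat.gcd_pos_of_pos_left n hm
  set g := Nat.gcd m n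
  have h1 : reduce m n = n' := by
    rw [reduce, show Nat.gcd m n = g from rfl]
    exact Nat.div_eq_of_eq_mul_left hg hn'
  have h2 : Nat.gcd (m * k) n = Nat.gcd k n' * g := by
    rw [hm', hn', mul_right_comm, Nat.gcd_mul_right, Nat.Coprime.gcd_mul_left_cancel k hcop]
  rw [h1, reduce, reduce, h2, hn', Nat.mul_div_mul_right _ _ hg]

theorem reduce_lcm (a b : ℕ) {m : ℕ} (hm : 0 < m) :
    reduce m (Nat.lcm a b) = Nat.lcm (reduce m a) (reduce m b) := by
  apply Nat.eq_of_mul_eq_mul_left hm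
  rw [mul_reduce, ← Nat.lcm_mul_left, mul_reduce, mul_reduce]
  apply Nat.dvd_antisymm
  · refine Nat.lcm_dvd ((Nat.dvd_lcm_left m a).trans (Nat.dvd_lcm_left _ _)) (Nat.lcm_dvd ?_ ?_)
    · exact (Nat.dvd_lcm_right m a).trans (Nat.dvd_lcm_left _ _)
    · exact (Nat.dvd_lcm_right m b).trans (Nat.dvd_lcm_right _ _)
  · refine Nat.lcm_dvd (Nat.lcm_dvd (Nat.dvd_lcm_left _ _) ?_)
      (Nat.lcm_dvd (Nat.dvd_lcm_left _ _) ?_)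
    · exact (Nat.dvd_lcm_left a b).trans (Nat.dvd_lcm_right _ _)
    · exact (Nat.dvd_lcm_right a b).trans (Nat.dvd_lcm_right _ _)

theorem reduce_finset_lcm {ι : Type*} (s : Finset ι) (u : ι → ℕ) {m : ℕ} (hm : 0 < m) :
    reduce m (s.lcm u) = s.lcm fun i => reduce m (u i) := by
  induction s using Finset.induction_on with
  | empty => simp [reduce_one_right]
  | insert i s _ ih =>
    rw [Finset.lcm_insert, Finset.lcm_insert, ← ih]
    exact reduce_lcm _ _ hm

/-- Reduction of a divisor `x` of `n` depends on `m` only through the reduction of `n`. -/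
theorem reduce_of_dvd {x n : ℕ} (m : ℕ) (hn : 0 < n) (hx : x ∣ n) :
    reduce m x = x / Nat.gcd (n / reduce m n) x := by
  have h : n / reduce m n = Nat.gcd m n := by
    conv_lhs => rw [← reduce_mul_gcd m n]
    rw [reduce_mul_gcd]
    exact Nat.div_eq_of_eq_mul_right (reduce_pos hn) (reduce_mul_gcd m n).symm
  rw [h, Nat.gcd_assoc, Nat.gcd_eq_right hx, reduce]

/-- The pullback of a ramification function under a rational function: the unique ramification
function on the source making `f` a minimal holomorphic map. -/
def pullback (f : RatFunc ℂ) (ν : OnePoint ℂ → ℕ) (z : OnePoint ℂ) : ℕ :=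
  reduce (locDeg f z) (ν (evalOP f z))

theorem isMinHolo_iff {f : RatFunc ℂ} (hf : Transcendental ℂ f) (O₁ O₂ : Orbifold) :
    IsMinHolo f O₁ O₂ ↔ pullback f O₂.nu = O₁.nu := by
  rw [funext_iff]
  refine forall_congr' fun z => ?_
  have hg : 0 < Nat.gcd (locDeg f z) (O₂.nu (evalOP f z)) :=
    Nat.gcd_pos_of_pos_left _ (locDeg_pos hf z)
  constructor
  · exact fun h => Nat.div_eq_of_eq_mul_left hg h
  · intro h
    rw [← h]
    exact (reduce_mul_gcd _ _).symm

theorem hasLocDeg_X (z : OnePoint ℂ) : HasLocDeg RatFunc.X z z 1 := by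
  refine ⟨le_rfl, 1, ?_, by rw [pow_one, mul_one]⟩
  induction z with
  | infty => exact ⟨1, one_ne_zero, by rw [flip_eq, map_one]; exact hasVal_one 0⟩
  | coe a => exact ⟨1, one_ne_zero, hasVal_one a⟩

theorem transcendental_riter {f : RatFunc ℂ} (hf : Transcendental ℂ f) (n : ℕ) :
    Transcendental ℂ (riter f n) := by
  induction n with
  | zero => exact RatFunc.transcendental_X
  | succ n ih =>
    rw [riter, rcomp_eq_substHom f ih]
    exact transcendental_substHom hf ih

theorem evalOP_riter {f : RatFunc ℂ} (hf : Transcendental ℂ f) (n : ℕ) (z : OnePoint ℂ) :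
    evalOP (riter f n) z = (evalOP f)^[n] z := by
  induction n with
  | zero => exact ((hasLocDeg_evalOP RatFunc.transcendental_X z).unique
      RatFunc.transcendental_X (hasLocDeg_X z)).1
  | succ n ih =>
    rw [riter, evalOP_rcomp hf (transcendental_riter hf n), ih, Function.iterate_succ_apply']

theorem pullback_rcomp {f g : RatFunc ℂ} (hf : Transcendental ℂ f) (hg : Transcendental ℂ g)
    (ν : OnePoint ℂ → ℕ) : pullback (rcomp f g) ν = pullback g (pullback f ν) := by
  funext z
  rw [pullback, pullback, pullback, evalOP_rcomp hf hg, locDeg_rcomp hf hg,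
    reduce_reduce _ _ (locDeg_pos hf _), mul_comm]

theorem pullback_riter {f : RatFunc ℂ} (hf : Transcendental ℂ f) (n : ℕ) (ν : OnePoint ℂ → ℕ) :
    pullback (riter f n) ν = (pullback f)^[n] ν := by
  induction n generalizing ν with
  | zero =>
    funext z
    have h := (hasLocDeg_evalOP RatFunc.transcendental_X z).unique
      RatFunc.transcendental_X (hasLocDeg_X z)
    rw [pullback, riter, h.1, h.2, reduce_one_left]
    rfl
  | succ n ih =>
    rw [riter, pullback_rcomp hf (transcendental_riter hf n), ih, Function.iterate_succ_apply]

theorem pullback_pos {f : RatFunc ℂ} {ν : OnePoint ℂ → ℕ} (hν : ∀ z, 0 < ν z) (z : OnePoint ℂ) :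
    0 < pullback f ν z :=
  reduce_pos (hν _)

theorem pullback_finite {f : RatFunc ℂ} (hf : Transcendental ℂ f) {ν : OnePoint ℂ → ℕ}
    (hν : {z | ν z ≠ 1}.Finite) : {z | pullback f ν z ≠ 1}.Finite := by
  refine (hν.toFinset.biUnion (fiber f)).finite_toSet.subset fun z hz => ?_
  rw [Finset.mem_coe, Finset.mem_biUnion]
  refine ⟨evalOP f z, ?_, (mem_fiber hf).mpr rfl⟩
  rw [Set.Finite.mem_toFinset]
  intro h
  exact hz (by rw [pullback, h, reduce_one_right])

theorem iterate_pullback_pos {f : RatFunc ℂ} {ν : OnePoint ℂ → ℕ} (hν : ∀ z, 0 < ν z) (n : ℕ)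
    (z : OnePoint ℂ) : 0 < (pullback f)^[n] ν z := by
  induction n generalizing z with
  | zero => exact hν z
  | succ n ih =>
    rw [Function.iterate_succ_apply']
    exact pullback_pos ih z

theorem iterate_pullback_finite {f : RatFunc ℂ} (hf : Transcendental ℂ f) {ν : OnePoint ℂ → ℕ}
    (hν : {z | ν z ≠ 1}.Finite) (n : ℕ) : {z | (pullback f)^[n] ν z ≠ 1}.Finite := by
  induction n with
  | zero => exact hν
  | succ n ih =>
    rw [Function.iterate_succ_apply']
    exact pullback_finite hf ih

/-- A ramification function invariant under pullback by a rational function of degree at least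
two has nonnegative Euler characteristic. -/
theorem sum_one_sub_inv_le_two {f : RatFunc ℂ} (hf : 2 ≤ rdeg f) {ν : OnePoint ℂ → ℕ}
    (hpos : ∀ z, 0 < ν z) (hinv : pullback f ν = ν) {c : Finset (OnePoint ℂ)}
    (hc : ∀ z, z ∈ c ↔ ν z ≠ 1) : ∑ z ∈ c, (1 - (ν z : ℚ)⁻¹) ≤ 2 := by
  have hft : Transcendental ℂ f := transcendental_iff_rdeg.mpr (by omega)
  set P := c.biUnion (fiber f) with hP
  have hmemP (z) : z ∈ P ↔ evalOP f z ∈ c := by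
    simp [hP, mem_fiber hft]
  have hmul (z) : ν (evalOP f z) = ν z * Nat.gcd (locDeg f z) (ν (evalOP f z)) := by
    conv_rhs => rw [← congrFun hinv z]
    exact (reduce_mul_gcd _ _).symm
  have hcP : c ⊆ P := by
    intro z hz
    rw [hmemP, hc]
    intro h
    exact (hc z).mp hz (Nat.dvd_one.mp (h ▸ Dvd.intro _ (hmul z).symm))
  have hdisj : (c : Set (OnePoint ℂ)).PairwiseDisjoint (fiber f) := by
    intro w _ w' _ hne
    refine Finset.disjoint_left.mpr fun z hz hz' => hne ?_
    rw [mem_fiber hft] at hz hz'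
    exact hz.symm.trans hz'
  have hsumP : ∑ z ∈ c, (1 - (ν z : ℚ)⁻¹) = ∑ z ∈ P, (1 - (ν z : ℚ)⁻¹) := by
    refine Finset.sum_subset hcP fun z _ hz => ?_
    rw [hc, not_not] at hz
    simp [hz]
  have hle : ∑ z ∈ P, (ν z : ℚ)⁻¹ ≤ ∑ w ∈ c, (rdeg f : ℚ) * (ν w : ℚ)⁻¹ := by
    rw [hP, Finset.sum_biUnion hdisj]
    refine Finset.sum_le_sum fun w _ => ?_
    rw [← sum_locDeg_fiber hft w, Nat.cast_sum, Finset.sum_mul]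
    refine Finset.sum_le_sum fun z hz => ?_
    rw [mem_fiber hft] at hz
    have h1 : ν w ≤ ν z * locDeg f z := by
      have h2 := hmul z
      rw [hz] at h2
      calc ν w = _ := h2
        _ ≤ _ := Nat.mul_le_mul_left _ (Nat.gcd_le_left _ (locDeg_pos hft z))
    have hw : (0 : ℚ) < ν w := by exact_mod_cast hpos w
    have hz0 : (0 : ℚ) < ν z := by exact_mod_cast hpos z
    have h1' : (ν w : ℚ) ≤ ν z * locDeg f z := by exact_mod_cast h1
    rw [← div_eq_mul_inv, ← one_div, div_le_div_iff₀ hz0 hw]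
    linarith
  have hdeg : ∑ z ∈ P, (locDeg f z : ℚ) = c.card * rdeg f := by
    rw [hP, Finset.sum_biUnion hdisj]
    rw [Finset.sum_congr rfl fun w _ => by rw [← Nat.cast_sum, sum_locDeg_fiber hft w]]
    simp
  have hRH : ∑ z ∈ P, (locDeg f z : ℚ) - P.card ≤ 2 * rdeg f - 2 := by
    have h := sum_locDeg_sub_one_le hft P
    have h' : ((∑ z ∈ P, (locDeg f z - 1) : ℕ) : ℚ) ≤ ((2 * rdeg f - 2 : ℕ) : ℚ) := by
      exact_mod_cast h
    rw [Nat.cast_sum, Nat.cast_sub (by omega)] at h'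
    rw [Finset.sum_congr rfl fun z _ => Nat.cast_sub (R := ℚ) (locDeg_pos hft z)] at h'
    simpa using h'
  have hd : (2 : ℚ) ≤ rdeg f := by exact_mod_cast hf
  rw [Finset.sum_sub_distrib] at hsumP ⊢
  rw [Finset.sum_sub_distrib, Finset.sum_const, Finset.sum_const] at hsumP
  rw [← Finset.mul_sum] at hle
  rw [Finset.sum_const]
  simp only [nsmul_eq_mul, mul_one] at hsumP ⊢
  set I := ∑ z ∈ c, (ν z : ℚ)⁻¹
  nlinarith

/-- A periodic ramification function which is not fixed under pullback is bounded by a fixed one,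
of nonnegative Euler characteristic, whose level sets it does not respect. -/
theorem exists_invariant_bound {f : RatFunc ℂ} (hf : 2 ≤ rdeg f) {ν : OnePoint ℂ → ℕ}
    (hpos : ∀ z, 0 < ν z) (hfin : {z | ν z ≠ 1}.Finite) {l : ℕ} (hl : 0 < l)
    (hper : (pullback f)^[l] ν = ν) (hne : pullback f ν ≠ ν) :
    ∃ (N : OnePoint ℂ → ℕ) (c : Finset (OnePoint ℂ)), (∀ z, 0 < N z) ∧ (∀ z, z ∈ c ↔ N z ≠ 1) ∧
      ∑ z ∈ c, (1 - (N z : ℚ)⁻¹) ≤ 2 ∧ (∀ z, ν z ∣ N z) ∧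
      ∃ z₁ z₂, N z₁ = N z₂ ∧ ν z₁ ≠ ν z₂ := by
  have hft : Transcendental ℂ f := transcendental_iff_rdeg.mpr (by omega)
  set N : OnePoint ℂ → ℕ := fun z => (Finset.range l).lcm fun i => (pullback f)^[i] ν z with hN
  have hdvd (i : ℕ) (hi : i < l) (z) : (pullback f)^[i] ν z ∣ N z :=
    Finset.dvd_lcm (f := fun i => (pullback f)^[i] ν z) (Finset.mem_range.mpr hi)
  have hNpos (z) : 0 < N z := by
    refine Nat.pos_of_ne_zero fun h => ?_
    obtain ⟨i, -, hi⟩ := Finset.lcm_eq_zero_iff.mp h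
    exact (iterate_pullback_pos hpos i z).ne' hi
  have hNfin : {z | N z ≠ 1}.Finite := by
    refine ((Finset.range l).finite_toSet.biUnion
      fun i _ => iterate_pullback_finite hft hfin i).subset fun z hz => ?_
    by_contra h
    simp only [Set.mem_iUnion, Set.mem_ofPred_eq, not_exists, not_not] at h
    refine hz (Nat.dvd_one.mp (Finset.lcm_dvd fun i hi => ?_))
    rw [h i hi]
  have hNinv : pullback f N = N := by
    funext z
    have h1 : pullback f N z = (Finset.range l).lcm fun i => (pullback f)^[i + 1] ν z := by
      rw [pullback, hN, reduce_finset_lcm _ _ (locDeg_pos hft z)]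
      simp only [Function.iterate_succ_apply']
      rfl
    rw [h1]
    apply Nat.dvd_antisymm
    · refine Finset.lcm_dvd fun i hi => ?_
      rw [Finset.mem_range] at hi
      rcases Nat.lt_or_ge (i + 1) l with h | h
      · exact hdvd _ h z
      · rw [show i + 1 = l by omega, hper]
        exact hdvd 0 hl z
    · refine Finset.lcm_dvd fun i hi => ?_
      rw [Finset.mem_range] at hi
      rcases i with - | i
      · have h2 := Finset.dvd_lcm (f := fun i => (pullback f)^[i + 1] ν z)
          (Finset.mem_range.mpr (show l - 1 < l by omega))
        rw [show l - 1 + 1 = l by omega, hper] at h2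
        exact h2
      · exact Finset.dvd_lcm (f := fun i => (pullback f)^[i + 1] ν z)
          (Finset.mem_range.mpr (show i < l by omega))
  refine ⟨N, hNfin.toFinset, hNpos, fun z => by simp,
    sum_one_sub_inv_le_two hf hNpos hNinv fun z => by simp, hdvd 0 hl, ?_⟩
  by_contra! hcon
  apply hne
  funext z
  set u : ℕ → ℕ := fun n => N ((evalOP f)^[n] z) with hu
  have hu1 (n) : u n ≤ u (n + 1) := by
    refine Nat.le_of_dvd (hNpos _) ?_
    rw [hu]
    simp only [Function.iterate_succ_apply']
    conv_lhs => rw [← hNinv]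
    exact reduce_dvd _ _
  have hmono : Monotone u := monotone_nat_of_le_succ hu1
  obtain ⟨n, hn⟩ : ∃ n, u (l * n) = u (l * n + 1) := by
    by_contra! h
    have hs : StrictMono fun n => u (l * n) := by
      refine strictMono_nat_of_lt_succ fun n => ?_
      refine (lt_of_le_of_ne (hu1 (l * n)) (h n)).trans_le (hmono ?_)
      rw [Nat.mul_add]
      omega
    obtain ⟨B, hB⟩ : ∃ B, ∀ z, N z ≤ B := by
      refine ⟨1 + ∑ w ∈ hNfin.toFinset, N w, fun z => ?_⟩
      by_cases hz : N z = 1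
      · omega
      · have := Finset.single_le_sum (f := N) (fun _ _ => Nat.zero_le _)
          (hNfin.mem_toFinset.mpr hz)
        omega
    have h1 := hs.le_apply (x := B + 1)
    have h2 : u (l * (B + 1)) ≤ B := hB _
    omega
  have hiter : (pullback f)^[l * n] ν = ν := by
    rw [Function.iterate_mul]
    exact Function.iterate_fixed hper n
  have hformula (k : ℕ) : (pullback f)^[k] ν z =
      ν ((evalOP f)^[k] z) / Nat.gcd (u k / N z) (ν ((evalOP f)^[k] z)) := by
    have hk : pullback (riter f k) N = N := by
      rw [pullback_riter hft]
      exact Function.iterate_fixed hNinv k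
    have hkz := congrFun hk z
    rw [pullback, evalOP_riter hft] at hkz
    rw [← pullback_riter hft, pullback, evalOP_riter hft,
      reduce_of_dvd (x := ν _) _ (hNpos _) (hdvd 0 hl _), hkz]
  have h1 := hformula (l * n)
  have h2 := hformula (l * n + 1)
  rw [← hn, ← hcon _ _ hn, ← h1, Function.iterate_succ_apply', hiter] at h2
  exact h2

/-! ### Classification of the possible signatures -/

theorem Orbifold.signature_eq_filter (O : Orbifold) {c : Finset (OnePoint ℂ)}
    (hc : ∀ z, O.nu z ≠ 1 → z ∈ c) :
    O.signature = (c.val.map O.nu).filter (· ≠ 1) := by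
  have h : O.finite.toFinset = c.filter fun z => O.nu z ≠ 1 := by
    ext z
    simpa using hc z
  rw [Orbifold.signature, h, Finset.filter_val, Multiset.filter_map]
  rfl

theorem Orbifold.Good.signature_ne_singleton {O : Orbifold} (hO : O.Good) (x : ℕ) :
    O.signature ≠ {x} := by
  intro h
  have hcard := congrArg Multiset.card h
  rw [Orbifold.signature, Multiset.card_map, Multiset.card_singleton] at hcard
  obtain ⟨z, hz⟩ := Finset.card_eq_one.mp hcard
  exact hO.1 ⟨z, by rw [← O.finite.coe_toFinset, hz, Finset.coe_singleton]⟩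

theorem Orbifold.Good.eq_of_signature_eq_pair {O : Orbifold} (hO : O.Good) {x y : ℕ}
    (h : O.signature = {x, y}) : x = y := by
  have hcard := congrArg Multiset.card h
  rw [Orbifold.signature, Multiset.card_map, Multiset.card_pair] at hcard
  obtain ⟨z, w, hzw, hs⟩ := Finset.card_eq_two.mp hcard
  have heq : O.nu z = O.nu w := by
    by_contra hne
    exact hO.2 ⟨z, w, hzw, by rw [← O.finite.coe_toFinset, hs, Finset.coe_pair], hne⟩
  have hsig : O.signature = {O.nu z, O.nu w} := by
    rw [Orbifold.signature, hs, Finset.insert_val_of_notMem (by simpa using hzw)]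
    rfl
  rw [h, heq] at hsig
  have hx : x ∈ ({O.nu w, O.nu w} : Multiset ℕ) := hsig ▸ by simp
  have hy : y ∈ ({O.nu w, O.nu w} : Multiset ℕ) := hsig ▸ by simp
  simp only [Multiset.insert_eq_cons, Multiset.mem_cons, Multiset.mem_singleton, or_self] at hx hy
  rw [hx, hy]

/-- A good orbifold which does not respect a level set of a multiple, of nonnegative Euler
characteristic, of its ramification function has one of four signatures. -/
theorem Orbifold.Good.signature_of_bound {O : Orbifold} (hO : O.Good) {N : OnePoint ℂ → ℕ}
    {c : Finset (OnePoint ℂ)} (hpos : ∀ z, 0 < N z) (hc : ∀ z, z ∈ c ↔ N z ≠ 1)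
    (hsum : ∑ z ∈ c, (1 - (N z : ℚ)⁻¹) ≤ 2) (hdvd : ∀ z, O.nu z ∣ N z) {z₁ z₂ : OnePoint ℂ}
    (hN : N z₁ = N z₂) (hne : O.nu z₁ ≠ O.nu z₂) :
    O.signature = {2, 2} ∨ O.signature = {3, 3} ∨ O.signature = {2, 2, 2} ∨
      O.signature = {2, 2, 4} := by
  have hz : z₁ ≠ z₂ := fun h => hne (by rw [h])
  have hN1 : N z₁ ≠ 1 := by
    intro h
    have h1 := hdvd z₁
    have h2 := hdvd z₂
    rw [← hN] at h2
    rw [h, Nat.dvd_one] at h1 h2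
    exact hne (h1.trans h2.symm)
  have hsig : O.signature = (c.val.map O.nu).filter (· ≠ 1) :=
    O.signature_eq_filter fun z h => (hc z).mpr fun h' => h (Nat.dvd_one.mp (h' ▸ hdvd z))
  obtain ⟨D, hD₁, hD₂, rfl⟩ : ∃ D, z₁ ∉ insert z₂ D ∧ z₂ ∉ D ∧ c = insert z₁ (insert z₂ D) := by
    have h1 : z₁ ∈ c := (hc _).mpr hN1
    have h2 : z₂ ∈ c.erase z₁ := Finset.mem_erase.mpr ⟨hz.symm, (hc _).mpr (hN ▸ hN1)⟩
    refine ⟨(c.erase z₁).erase z₂, ?_, Finset.notMem_erase _ _, ?_⟩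
    · rw [Finset.insert_erase h2]
      exact Finset.notMem_erase _ _
    · rw [Finset.insert_erase h2, Finset.insert_erase h1]
  have hDN (z) (hzD : z ∈ D) : 2 ≤ N z := by
    have h1 := (hc z).mp (Finset.mem_insert_of_mem (Finset.mem_insert_of_mem hzD))
    have h2 := hpos z
    omega
  rw [Finset.sum_insert hD₁, Finset.sum_insert hD₂, ← hN] at hsum
  rw [Finset.insert_val_of_notMem hD₁, Finset.insert_val_of_notMem hD₂, Multiset.map_cons,
    Multiset.map_cons] at hsig
  have hx := hdvd z₁
  have hy := hdvd z₂
  rw [← hN] at hy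
  have hn : 2 ≤ N z₁ := by
    have := hpos z₁
    omega
  generalize N z₁ = n at *
  generalize O.nu z₁ = x at *
  generalize O.nu z₂ = y at *
  have hhalf (k : ℕ) (hk : 2 ≤ k) : (k : ℚ)⁻¹ ≤ 1 / 2 := by
    rw [one_div]
    exact inv_anti₀ two_pos (by exact_mod_cast hk)
  have hterm (z) (hzD : z ∈ D) : (1 / 2 : ℚ) ≤ 1 - (N z : ℚ)⁻¹ := by
    linarith [hhalf _ (hDN z hzD)]
  have hcard : (D.card : ℚ) ≤ 2 := by
    have h1 := Finset.card_nsmul_le_sum D _ _ hterm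
    rw [nsmul_eq_mul] at h1
    linarith [hhalf n hn]
  have hcard' : D.card ≤ 2 := by exact_mod_cast hcard
  have hS1 := hO.signature_ne_singleton
  have hS2 : ∀ {x y : ℕ}, O.signature = {x, y} → x = y := hO.eq_of_signature_eq_pair
  generalize O.signature = S at *
  obtain hD | hD | hD : D.card = 0 ∨ D.card = 1 ∨ D.card = 2 := by omega
  · rw [Finset.card_eq_zero] at hD
    subst hD
    exfalso
    by_cases hx1 : x = 1
    · exact hS1 y (by simpa [hx1, show y ≠ 1 by omega, Multiset.filter_singleton] using hsig)
    by_cases hy1 : y = 1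
    · exact hS1 x (by simpa [hx1, hy1, Multiset.filter_singleton] using hsig)
    · exact hne (hS2 (by simpa [hx1, hy1, Multiset.filter_singleton] using hsig))
  · obtain ⟨z₃, rfl⟩ := Finset.card_eq_one.mp hD
    have hM := hDN z₃ (by simp)
    have hw := hdvd z₃
    simp only [Finset.sum_singleton, Finset.singleton_val, Multiset.map_singleton] at hsum hsig
    generalize N z₃ = M at *
    generalize O.nu z₃ = w at *
    have hn4 : n ≤ 4 := by
      by_contra! h
      have h1 : (n : ℚ)⁻¹ ≤ 5⁻¹ := inv_anti₀ (by norm_num) (by exact_mod_cast h)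
      linarith [hhalf M hM]
    obtain rfl | rfl | rfl : n = 2 ∨ n = 3 ∨ n = 4 := by omega
    · have hS : S = Multiset.filter (· ≠ 1) {2, w} := by
        rw [Nat.dvd_prime Nat.prime_two] at hx hy
        obtain ⟨rfl, rfl⟩ | ⟨rfl, rfl⟩ : x = 1 ∧ y = 2 ∨ x = 2 ∧ y = 1 := by omega
        all_goals rw [hsig]; simp
      by_cases hw1 : w = 1
      · exact (hS1 2 (by simpa [hw1, Multiset.filter_singleton] using hS)).elim
      · have hS' : S = {2, w} := by simpa [hw1, Multiset.filter_singleton] using hS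
        exact Or.inl (hS2 hS' ▸ hS')
    · have hM3 : M ≤ 3 := by
        by_contra! h
        have h1 : (M : ℚ)⁻¹ ≤ 4⁻¹ := inv_anti₀ (by norm_num) (by exact_mod_cast h)
        norm_num at hsum
        linarith
      have hS : S = Multiset.filter (· ≠ 1) {3, w} := by
        rw [Nat.dvd_prime Nat.prime_three] at hx hy
        obtain ⟨rfl, rfl⟩ | ⟨rfl, rfl⟩ : x = 1 ∧ y = 3 ∨ x = 3 ∧ y = 1 := by omega
        all_goals rw [hsig]; simp
      by_cases hw1 : w = 1
      · exact (hS1 3 (by simpa [hw1, Multiset.filter_singleton] using hS)).elim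
      · have hS' : S = {3, w} := by simpa [hw1, Multiset.filter_singleton] using hS
        exact Or.inr (Or.inl (hS2 hS' ▸ hS'))
    · have hM2 : M = 2 := by
        by_contra h
        have h1 : (M : ℚ)⁻¹ ≤ 3⁻¹ := inv_anti₀ (by norm_num) (by norm_cast; omega)
        norm_num at hsum
        linarith
      subst hM2
      have h4 {k : ℕ} (hk : k ∣ 4) : k = 1 ∨ k = 2 ∨ k = 4 := by
        have := Nat.le_of_dvd (by norm_num) hk
        interval_cases k <;> omega
      rw [Nat.dvd_prime Nat.prime_two] at hw
      rcases h4 hx with rfl | rfl | rfl <;> rcases h4 hy with rfl | rfl | rfl <;>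
        rcases hw with rfl | rfl <;> first
        | exact absurd rfl hne
        | exact absurd (hsig.trans (by decide)) (hS1 2)
        | exact absurd (hsig.trans (by decide)) (hS1 4)
        | exact absurd (hS2 (x := 2) (y := 4) (hsig.trans (by decide))) (by norm_num)
        | exact Or.inl (hsig.trans (by decide))
        | exact Or.inr (Or.inr (Or.inr (hsig.trans (by decide))))
  · obtain ⟨z₃, z₄, h34, rfl⟩ := Finset.card_eq_two.mp hD
    have h3 := hDN z₃ (by simp)
    have h4 := hDN z₄ (by simp)
    have hw3 := hdvd z₃
    have hw4 := hdvd z₄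
    rw [Finset.sum_pair h34] at hsum
    rw [Finset.insert_val_of_notMem (by simpa using h34), Finset.singleton_val, Multiset.map_cons,
      Multiset.map_singleton] at hsig
    generalize N z₃ = M₃ at *
    generalize N z₄ = M₄ at *
    generalize O.nu z₃ = w₃ at *
    generalize O.nu z₄ = w₄ at *
    have htwo (k : ℕ) (hk : 2 ≤ k) (h : (1 / 2 : ℚ) ≤ (k : ℚ)⁻¹) : k = 2 := by
      by_contra hk2
      have h1 : (k : ℚ)⁻¹ ≤ 3⁻¹ := inv_anti₀ (by norm_num) (by norm_cast; omega)
      norm_num at h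
      linarith
    obtain rfl := htwo n hn (by linarith [hhalf n hn, hhalf M₃ h3, hhalf M₄ h4])
    obtain rfl := htwo M₃ h3 (by linarith [hhalf 2 hn, hhalf M₃ h3, hhalf M₄ h4])
    obtain rfl := htwo M₄ h4 (by linarith [hhalf 2 hn, hhalf 2 h3, hhalf M₄ h4])
    rw [Nat.dvd_prime Nat.prime_two] at hx hy hw3 hw4
    rcases hx with rfl | rfl <;> rcases hy with rfl | rfl <;>
      rcases hw3 with rfl | rfl <;> rcases hw4 with rfl | rfl <;> first
      | exact absurd rfl hne
      | exact absurd (hsig.trans (by decide)) (hS1 2)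
      | exact Or.inl (hsig.trans (by decide))
      | exact Or.inr (Or.inr (Or.inl (hsig.trans (by decide))))

/-- **Corollary (iterates in `E(O)`).** If `A^{∘l} ∈ E(O)` for some `l ≥ 2` and the
signature of `O` is not `{2,2}`, `{3,3}`, `{2,2,2}` or `{2,2,4}`, then `A ∈ E(O)`. -/
theorem iterate_in_E (A : RatFunc ℂ) (hA : 2 ≤ rdeg A) (O : Orbifold) (hO : O.Good)
    (l : ℕ) (hl : 2 ≤ l) (h : IsMinHolo (riter A l) O O)
    (hs1 : O.signature ≠ ({2, 2} : Multiset ℕ))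
    (hs2 : O.signature ≠ ({3, 3} : Multiset ℕ))
    (hs3 : O.signature ≠ ({2, 2, 2} : Multiset ℕ))
    (hs4 : O.signature ≠ ({2, 2, 4} : Multiset ℕ)) :
    IsMinHolo A O O := by
  have hft : Transcendental ℂ A := transcendental_iff_rdeg.mpr (by omega)
  rw [isMinHolo_iff (transcendental_riter hft l), pullback_riter hft] at h
  rw [isMinHolo_iff hft]
  by_contra hne
  obtain ⟨N, c, hpos, hc, hsum, hdvd, z₁, z₂, hN, hz⟩ :=
    exists_invariant_bound hA O.one_le O.finite (by omega) h hne
  rcases hO.signature_of_bound hpos hc hsum hdvd hN hz with hs | hs | hs | hs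
  · exact hs1 hs
  · exact hs2 hs
  · exact hs3 hs
  · exact hs4 hs

end GenLattes
end
end

section
/- Let A be a rational map of the Riemann sphere of degree d ≥ 2. If for some l ≥ 1 the iterate A^{∘l} is conjugate to z ↦ z^{d^l} or to z ↦ z^{−d^l}, then A is conjugate to z ↦ z^d or to z ↦ z^{−d}. Similarly, if A^{∘l} is conjugate to T_{d^l} or to −T_{d^l}, then A is conjugate to T_d or to −T_d. -/
open Polynomial OnePoint
open scoped Classical

noncomputable section

namespace GenLattes

/-! ### Composition of rational functions -/

/-- Right composition with a nonconstant rational function, as an algebra homomorphism. -/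
def compHom (g : RatFunc ℂ) (hg : Transcendental ℂ g) : RatFunc ℂ →ₐ[ℂ] RatFunc ℂ :=
  RatFunc.liftAlgHom (Polynomial.aeval g)
    (nonZeroDivisors_le_comap_nonZeroDivisors_of_injective _
      (transcendental_iff_injective.mp hg))

lemma compHom_apply (g : RatFunc ℂ) (hg : Transcendental ℂ g) (f : RatFunc ℂ) :
    compHom g hg f = rcomp f g :=
  RatFunc.liftAlgHom_apply _ _ f

lemma rcomp_algebraMap (p : ℂ[X]) (g : RatFunc ℂ) :
    rcomp (algebraMap ℂ[X] (RatFunc ℂ) p) g = Polynomial.aeval g p := by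
  simp [rcomp]

lemma rcomp_X_left (g : RatFunc ℂ) : rcomp RatFunc.X g = g := by
  simp [rcomp]

lemma aeval_algebraMap_ratFunc (p q : ℂ[X]) :
    Polynomial.aeval (algebraMap ℂ[X] (RatFunc ℂ) p) q =
      algebraMap ℂ[X] (RatFunc ℂ) (q.comp p) := by
  rw [Polynomial.aeval_algebraMap_apply, Polynomial.comp_eq_aeval]

lemma rcomp_X_right (f : RatFunc ℂ) : rcomp f RatFunc.X = f := by
  rw [rcomp, ← RatFunc.algebraMap_X, aeval_algebraMap_ratFunc, aeval_algebraMap_ratFunc,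
    comp_X, comp_X, RatFunc.num_div_denom]

lemma rcomp_assoc (f g : RatFunc ℂ) {h : RatFunc ℂ} (hh : Transcendental ℂ h) :
    rcomp (rcomp f g) h = rcomp f (rcomp g h) := by
  rw [← compHom_apply h hh, ← compHom_apply h hh, rcomp, rcomp, map_div₀,
    Polynomial.aeval_algHom_apply, Polynomial.aeval_algHom_apply]

lemma transcendental_rcomp {f g : RatFunc ℂ} (hf : Transcendental ℂ f)
    (hg : Transcendental ℂ g) : Transcendental ℂ (rcomp f g) := by
  rw [← compHom_apply g hg]
  rwa [Transcendental, isAlgebraic_algHom_iff (compHom g hg) (compHom g hg).toRingHom.injective]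

lemma transcendental_X : Transcendental ℂ (RatFunc.X : RatFunc ℂ) :=
  RatFunc.transcendental_of_ne_C _ <| by
    rintro ⟨c, hc⟩
    have := congrArg RatFunc.intDegree hc
    simp at this

lemma transcendental_of_transcendental_rcomp {f g : RatFunc ℂ}
    (h : Transcendental ℂ (rcomp f g)) : Transcendental ℂ g := by
  intro hg
  have key (p : ℂ[X]) : IsAlgebraic ℂ (Polynomial.aeval g p) :=
    isAlgebraic_iff_isIntegral.mpr
      (IsIntegral.of_mem_of_fg _ hg.isIntegral.fg_adjoin_singleton _
        (Polynomial.aeval_mem_adjoin_singleton ℂ g))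
  refine h ?_
  rw [rcomp, div_eq_mul_inv]
  exact (key _).mul (key _).inv

lemma transcendental_of_rcomp_eq_X {f g : RatFunc ℂ} (h : rcomp f g = RatFunc.X) :
    Transcendental ℂ g :=
  transcendental_of_transcendental_rcomp (h ▸ transcendental_X)

lemma transcendental_of_rdeg_ne_zero {A : RatFunc ℂ} (h : rdeg A ≠ 0) : Transcendental ℂ A :=
  RatFunc.transcendental_of_ne_C _ <| by
    rintro ⟨c, rfl⟩
    simp [rdeg] at h

lemma transcendental_riter_s10 {A : RatFunc ℂ} (hA : Transcendental ℂ A) (l : ℕ) :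
    Transcendental ℂ (riter A l) := by
  induction l with
  | zero => exact transcendental_X
  | succ l ih => exact transcendental_rcomp hA ih

lemma rcomp_riter_comm {A : RatFunc ℂ} (hA : Transcendental ℂ A) (l : ℕ) :
    rcomp A (riter A l) = rcomp (riter A l) A := by
  induction l with
  | zero => simp [riter, rcomp_X_left, rcomp_X_right]
  | succ l ih => rw [riter, rcomp_assoc _ _ hA, ← ih]

lemma riter_conj {A μ ν : RatFunc ℂ} (hA : Transcendental ℂ A) (hμν : rcomp μ ν = RatFunc.X)
    (hνμ : rcomp ν μ = RatFunc.X) (l : ℕ) :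
    riter (rcomp (rcomp ν A) μ) l = rcomp (rcomp ν (riter A l)) μ := by
  have hμ := transcendental_of_rcomp_eq_X hνμ
  have hν := transcendental_of_rcomp_eq_X hμν
  induction l with
  | zero => rw [riter, riter, rcomp_X_right, hνμ]
  | succ l ih =>
    have hl := transcendental_riter_s10 hA l
    have hlμ := transcendental_rcomp hl hμ
    rw [riter, ih, riter, rcomp_assoc ν (riter A l) hμ,
      rcomp_assoc _ μ (transcendental_rcomp hν hlμ), ← rcomp_assoc μ ν hlμ, hμν, rcomp_X_left,
      ← rcomp_assoc (rcomp ν A) _ hμ, rcomp_assoc ν A hl]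

lemma Conjugate.exists_riter_eq {A P : RatFunc ℂ} (hA : Transcendental ℂ A) {l : ℕ}
    (h : Conjugate (riter A l) P) :
    ∃ B, Transcendental ℂ B ∧ riter B l = P ∧ ∀ Q, Conjugate B Q → Conjugate A Q := by
  obtain ⟨μ, ν, hμν, hνμ, hP⟩ := h
  have hμ := transcendental_of_rcomp_eq_X hνμ
  have hν := transcendental_of_rcomp_eq_X hμν
  have hPμ : rcomp (riter A l) μ = rcomp μ P := by
    rw [hP, rcomp_assoc _ ν hμ, hνμ, rcomp_X_right]
  have hPt : Transcendental ℂ P := transcendental_of_transcendental_rcomp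
    (hPμ ▸ transcendental_rcomp (transcendental_riter_s10 hA l) hμ)
  refine ⟨rcomp (rcomp ν A) μ,
    transcendental_rcomp (transcendental_rcomp hν hA) hμ, ?_, ?_⟩
  · rw [riter_conj hA hμν hνμ, rcomp_assoc _ _ hμ, hPμ, ← rcomp_assoc _ _ hPt, hνμ,
      rcomp_X_left]
  · rintro Q ⟨σ, τ, hστ, hτσ, hQ⟩
    have hσ := transcendental_of_rcomp_eq_X hτσ
    have hτ := transcendental_of_rcomp_eq_X hστ
    have hA' : A = rcomp μ (rcomp (rcomp (rcomp ν A) μ) ν) := by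
      rw [rcomp_assoc _ μ hν, hμν, rcomp_X_right, ← rcomp_assoc _ _ hA, hμν, rcomp_X_left]
    have hQt : Transcendental ℂ Q := by
      have h : rcomp (rcomp (rcomp ν A) μ) σ = rcomp σ Q := by
        rw [hQ, rcomp_assoc _ τ hσ, hτσ, rcomp_X_right]
      exact transcendental_of_transcendental_rcomp (h ▸ transcendental_rcomp
        (transcendental_rcomp (transcendental_rcomp hν hA) hμ) hσ)
    refine ⟨rcomp μ σ, rcomp τ ν, ?_, ?_, ?_⟩
    · rw [← rcomp_assoc _ _ hν, rcomp_assoc μ σ hτ, hστ, rcomp_X_right, hμν]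
    · rw [← rcomp_assoc _ _ hσ, rcomp_assoc τ ν hμ, hνμ, rcomp_X_right, hτσ]
    · rw [hA', hQ, ← rcomp_assoc _ _ hν, ← rcomp_assoc _ _ hτ, ← rcomp_assoc _ _ hQt,
        ← rcomp_assoc _ τ hν]

/-! ### Rational functions commuting with a power map -/

lemma comp_ne_zero_of_natDegree_ne_zero {f P : ℂ[X]} (hf : f ≠ 0) (hP : P.natDegree ≠ 0) :
    f.comp P ≠ 0 := fun h0 => by
  rcases comp_eq_zero_iff.mp h0 with h1 | ⟨-, h1⟩
  · exact hf h1
  · exact hP (by rw [h1, natDegree_C])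

/-- If `q / p` is invariant under composition with a polynomial of degree at least two,
then it is constant. -/
lemma exists_eq_C_mul_of_comp_mul_eq {P p q : ℂ[X]} (hP : 2 ≤ P.natDegree) (hp : p ≠ 0)
    (h : q.comp P * p = p.comp P * q) : ∃ c, q = Polynomial.C c * p := by
  have hcomp (f : ℂ[X]) (hf : f ≠ 0) : f.comp P ≠ 0 :=
    comp_ne_zero_of_natDegree_ne_zero hf (by omega)
  have key (f : ℂ[X]) (hf : f ≠ 0) (h : f.comp P * p = p.comp P * f) :
      f.natDegree = p.natDegree := by
    have h1 := congrArg natDegree h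
    rw [natDegree_mul (hcomp f hf) hp, natDegree_mul (hcomp p hp) hf, natDegree_comp,
      natDegree_comp] at h1
    obtain ⟨k, hk⟩ := Nat.exists_eq_add_of_le hP
    rw [hk] at h1
    rcases lt_trichotomy f.natDegree p.natDegree with h2 | h2 | h2
    · nlinarith
    · exact h2
    · nlinarith
  by_cases hq : q = 0
  · exact ⟨0, by simp [hq]⟩
  set c := q.leadingCoeff / p.leadingCoeff with hc
  have hp' : p.leadingCoeff ≠ 0 := leadingCoeff_ne_zero.mpr hp
  have hc0 : c ≠ 0 := div_ne_zero (leadingCoeff_ne_zero.mpr hq) hp'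
  refine ⟨c, sub_eq_zero.mp ?_⟩
  by_contra hne
  have hdeg : (Polynomial.C c * p).degree = q.degree := by
    rw [degree_C_mul hc0, degree_eq_natDegree hp, degree_eq_natDegree hq, key q hq h]
  have hlt := degree_sub_lt_left hdeg.symm hq (by
    rw [leadingCoeff_mul, leadingCoeff_C, hc, div_mul_cancel₀ _ hp'])
  have h1 := key _ hne (by
    simp only [sub_comp, mul_comp, C_comp]
    linear_combination h)
  rw [degree_eq_natDegree hne, degree_eq_natDegree hq, h1, key q hq h] at hlt
  exact lt_irrefl _ hlt

lemma eq_C_mul_X_pow_of_comp_X_pow_eq {N : ℕ} (hN : 2 ≤ N) {a : ℂ[X]} (ha : a ≠ 0)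
    (h : a.comp (X ^ N) = a ^ N) :
    a = Polynomial.C a.leadingCoeff * X ^ a.natDegree := by
  obtain ⟨M, rfl⟩ : ∃ M, N = M + 1 := ⟨N - 1, by omega⟩
  have hd := congrArg derivative h
  rw [derivative_comp, derivative_X_pow, derivative_pow] at hd
  simp only [Nat.add_sub_cancel] at hd
  have hM : (Polynomial.C ((M + 1 : ℕ) : ℂ)) ≠ 0 := by
    rw [Ne, Polynomial.C_eq_zero]
    exact_mod_cast Nat.succ_ne_zero M
  have hd' : X ^ M * (derivative a).comp (X ^ (M + 1)) = a ^ M * derivative a := by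
    apply mul_left_cancel₀ hM
    linear_combination hd
  obtain ⟨c, hc⟩ := exists_eq_C_mul_of_comp_mul_eq (P := X ^ (M + 1)) (p := a)
    (q := X * derivative a) (by simpa using hN) ha (by
      rw [mul_comp, X_comp, h]
      linear_combination X * a * hd')
  have hcoeff (i : ℕ) : (i : ℂ) * a.coeff i = c * a.coeff i := by
    have := congrArg (fun p => p.coeff i) hc
    simp only [coeff_C_mul] at this
    rw [← this]
    cases i with
    | zero => simp
    | succ i => rw [coeff_X_mul, coeff_derivative]; push_cast; ring
  have hcn : (a.natDegree : ℂ) = c :=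
    mul_right_cancel₀ (leadingCoeff_ne_zero.mpr ha) (hcoeff a.natDegree)
  ext i
  rw [coeff_C_mul, coeff_X_pow]
  split_ifs with hi
  · rw [hi, mul_one, leadingCoeff]
  · rw [mul_zero]
    by_contra hne
    have := mul_right_cancel₀ hne (hcoeff i)
    rw [← hcn] at this
    exact hi (by exact_mod_cast this)

lemma algebraMap_C_ratFunc (c : ℂ) :
    algebraMap ℂ[X] (RatFunc ℂ) (Polynomial.C c) = RatFunc.C c :=
  RatFunc.algebraMap_C c

lemma rcomp_C_mul_X_zpow (c : ℂ) (k : ℤ) {g : RatFunc ℂ}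
    (hg : Transcendental ℂ g) :
    rcomp (RatFunc.C c * RatFunc.X ^ k) g = RatFunc.C c * g ^ k := by
  rw [← compHom_apply g hg, map_mul, map_zpow₀, compHom_apply, compHom_apply, rcomp_X_left,
    ← algebraMap_C_ratFunc, rcomp_algebraMap, aeval_C]
  rfl

lemma ratFunc_C_ne_zero {c : ℂ} (hc : c ≠ 0) : RatFunc.C c ≠ (0 : RatFunc ℂ) := by
  simpa using hc

lemma intDegree_C_mul_X_zpow {c : ℂ} (hc : c ≠ 0) (k : ℤ) :
    (RatFunc.C c * RatFunc.X ^ k : RatFunc ℂ).intDegree = k := by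
  have hX (n : ℕ) : (RatFunc.X ^ n : RatFunc ℂ).intDegree = n := by
    rw [← RatFunc.algebraMap_X, ← map_pow, RatFunc.intDegree_polynomial, natDegree_X_pow]
  rw [RatFunc.intDegree_mul (ratFunc_C_ne_zero hc) (zpow_ne_zero _ RatFunc.X_ne_zero),
    RatFunc.intDegree_C, zero_add]
  obtain ⟨n, rfl | rfl⟩ := k.eq_nat_or_neg
  · rw [zpow_natCast, hX]
  · rw [zpow_neg, zpow_natCast, RatFunc.intDegree_inv, hX]

lemma transcendental_C_mul_X_zpow {c : ℂ} (hc : c ≠ 0) {k : ℤ} (hk : k ≠ 0) :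
    Transcendental ℂ (RatFunc.C c * RatFunc.X ^ k : RatFunc ℂ) :=
  RatFunc.transcendental_of_ne_C _ <| by
    rintro ⟨a, ha⟩
    have := congrArg RatFunc.intDegree ha
    rw [intDegree_C_mul_X_zpow hc, RatFunc.intDegree_C] at this
    exact hk this

/-- A rational function commuting with `z ↦ z ^ N`, `N ≥ 2`, is a monomial. -/
lemma exists_eq_C_mul_X_zpow_of_comm {B : RatFunc ℂ} (hB : Transcendental ℂ B) {N : ℕ}
    (hN : 2 ≤ N) (h : rcomp B (RatFunc.X ^ N) = B ^ N) :
    ∃ c : ℂ, c ≠ 0 ∧ ∃ k : ℤ, B = RatFunc.C c * RatFunc.X ^ k := by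
  have hB0 : B ≠ 0 := by
    rintro rfl
    exact hB isAlgebraic_zero
  have hinj := RatFunc.algebraMap_injective ℂ
  have hb0 := B.denom_ne_zero
  have ha0 := RatFunc.num_ne_zero hB0
  have hbm := B.monic_denom
  have hNX : (X ^ N : ℂ[X]).natDegree ≠ 0 := by rw [natDegree_X_pow]; omega
  have hbcomp : (B.denom.comp (X ^ N)).Monic := hbm.comp (monic_X_pow N) hNX
  have hpoly : B.num.comp (X ^ N) * B.denom ^ N = B.num ^ N * B.denom.comp (X ^ N) := by
    rw [rcomp, ← RatFunc.algebraMap_X, ← map_pow, aeval_algebraMap_ratFunc,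
      aeval_algebraMap_ratFunc] at h
    nth_rewrite 3 [← RatFunc.num_div_denom B] at h
    rw [div_pow, div_eq_div_iff, ← map_pow, ← map_pow, ← map_mul, ← map_mul] at h
    · exact hinj h
    · simpa using hbcomp.ne_zero
    · exact pow_ne_zero _ ((map_ne_zero_iff _ hinj).mpr hb0)
  have hcop := B.isCoprime_num_denom
  have hcop1 : IsCoprime (B.num ^ N) (B.denom ^ N) := hcop.pow
  have hcop2 : IsCoprime (B.num.comp (X ^ N)) (B.denom.comp (X ^ N)) := by
    simpa only [coe_compRingHom_apply] using hcop.map (compRingHom (X ^ N : ℂ[X]))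
  have hb : B.denom.comp (X ^ N) = B.denom ^ N :=
    eq_of_monic_of_associated hbcomp (hbm.pow N) <| associated_of_dvd_dvd
      (hcop2.symm.dvd_of_dvd_mul_left ⟨_, by rw [hpoly, mul_comm]⟩)
      (hcop1.symm.dvd_of_dvd_mul_left ⟨_, by rw [← hpoly, mul_comm]⟩)
  have ha : B.num.comp (X ^ N) = B.num ^ N := by
    rw [hb] at hpoly
    exact mul_right_cancel₀ (pow_ne_zero _ hb0) hpoly
  have hb' := eq_C_mul_X_pow_of_comp_X_pow_eq hN hb0 hb
  have ha' := eq_C_mul_X_pow_of_comp_X_pow_eq hN ha0 ha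
  refine ⟨B.num.leadingCoeff, leadingCoeff_ne_zero.mpr ha0,
    (B.num.natDegree : ℤ) - B.denom.natDegree, ?_⟩
  rw [hbm.leadingCoeff, Polynomial.C_1, one_mul] at hb'
  nth_rewrite 1 [← RatFunc.num_div_denom B]
  rw [ha', hb', zpow_sub₀ RatFunc.X_ne_zero]
  simp [mul_div_assoc, ha0]

lemma exists_riter_C_mul_X_zpow {c : ℂ} (hc : c ≠ 0) {k : ℤ} (hk : k ≠ 0) (l : ℕ) :
    ∃ c' : ℂ, c' ≠ 0 ∧
      riter (RatFunc.C c * RatFunc.X ^ k) l = RatFunc.C c' * RatFunc.X ^ (k ^ l) := by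
  induction l with
  | zero => exact ⟨1, one_ne_zero, by simp [riter]⟩
  | succ l ih =>
    obtain ⟨c', hc', ih⟩ := ih
    refine ⟨c * c' ^ k, mul_ne_zero hc (zpow_ne_zero _ hc'), ?_⟩
    rw [riter, ih, rcomp_C_mul_X_zpow _ _
      (transcendental_C_mul_X_zpow hc' (pow_ne_zero _ hk)), mul_zpow, ← zpow_mul, pow_succ,
      map_mul, map_zpow₀, mul_assoc]

lemma exists_zpow_eq {m : ℤ} (hm : m ≠ 0) {c : ℂ} (hc : c ≠ 0) : ∃ z : ℂ, z ≠ 0 ∧ z ^ m = c := by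
  obtain ⟨z, hz⟩ := IsAlgClosed.exists_pow_nat_eq c (Int.natAbs_pos.mpr hm)
  have hz0 : z ≠ 0 := by
    rintro rfl
    rw [zero_pow (Int.natAbs_ne_zero.mpr hm)] at hz
    exact hc hz.symm
  rcases m.natAbs_eq with h | h
  · exact ⟨z, hz0, by rw [h, zpow_natCast, hz]⟩
  · exact ⟨z⁻¹, inv_ne_zero hz0, by rw [h, zpow_neg, inv_zpow, inv_inv, zpow_natCast, hz]⟩

lemma conjugate_C_mul_X_zpow {c : ℂ} (hc : c ≠ 0) {k : ℤ} (hk : k ≠ 0) (hk1 : k ≠ 1) :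
    Conjugate (RatFunc.C c * RatFunc.X ^ k) (RatFunc.X ^ k) := by
  obtain ⟨z, hz, hzc⟩ := exists_zpow_eq (sub_ne_zero.mpr hk1.symm) hc
  have hz' := inv_ne_zero hz
  have hCz := ratFunc_C_ne_zero hz
  have ht {w : ℂ} (hw : w ≠ 0) : Transcendental ℂ (RatFunc.C w * RatFunc.X : RatFunc ℂ) := by
    simpa using transcendental_C_mul_X_zpow hw one_ne_zero
  have htk : Transcendental ℂ (RatFunc.X ^ k : RatFunc ℂ) := by
    simpa using transcendental_C_mul_X_zpow one_ne_zero hk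
  have hcomp (w : ℂ) {g : RatFunc ℂ} (hg : Transcendental ℂ g) :
      rcomp (RatFunc.C w * RatFunc.X) g = RatFunc.C w * g := by
    simpa using rcomp_C_mul_X_zpow w 1 hg
  refine ⟨RatFunc.C z * RatFunc.X, RatFunc.C z⁻¹ * RatFunc.X, ?_, ?_, ?_⟩
  · rw [hcomp _ (ht hz'), ← mul_assoc, ← map_mul, mul_inv_cancel₀ hz, map_one, one_mul]
  · rw [hcomp _ (ht hz), ← mul_assoc, ← map_mul, inv_mul_cancel₀ hz, map_one, one_mul]
  · rw [hcomp _ htk, rcomp_C_mul_X_zpow _ _ (ht hz'), mul_zpow, ← mul_assoc,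
      ← map_zpow₀, ← map_mul, ← hzc, zpow_sub₀ hz, zpow_one, inv_zpow, div_eq_mul_inv]

lemma conjugate_of_riter_eq_X_zpow {B : RatFunc ℂ} (hB : Transcendental ℂ B) {d l : ℕ}
    (hd : 2 ≤ d) (hl : 1 ≤ l) {e : ℤ} (he : e.natAbs = d ^ l)
    (h : riter B l = RatFunc.X ^ e) :
    Conjugate B (RatFunc.X ^ d) ∨ Conjugate B (RatFunc.X ^ d)⁻¹ := by
  have hdl : 2 ≤ d ^ l := hd.trans (Nat.le_self_pow (by omega) d)
  have he0 : e ≠ 0 := by omega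
  have hXe : Transcendental ℂ (RatFunc.X ^ e : RatFunc ℂ) := by
    simpa using transcendental_C_mul_X_zpow one_ne_zero he0
  have hpow {g : RatFunc ℂ} (hg : Transcendental ℂ g) : rcomp (RatFunc.X ^ e) g = g ^ e := by
    simpa using rcomp_C_mul_X_zpow 1 e hg
  have hcomm : rcomp B (RatFunc.X ^ e) = B ^ e := by
    rw [← hpow hB, ← h, rcomp_riter_comm hB]
  have hN : rcomp B (RatFunc.X ^ (d ^ l * d ^ l)) = B ^ (d ^ l * d ^ l) := by
    have hee : ((d ^ l * d ^ l : ℕ) : ℤ) = e * e := by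
      rw [← he, Int.natCast_mul, Int.natAbs_mul_self']
    rw [← zpow_natCast, ← zpow_natCast, hee, zpow_mul, zpow_mul, ← hpow hXe,
      ← rcomp_assoc _ _ hXe, hcomm, ← compHom_apply _ hXe, map_zpow₀, compHom_apply, hcomm]
  obtain ⟨c, hc, k, rfl⟩ := exists_eq_C_mul_X_zpow_of_comm hB (by nlinarith) hN
  have hk : k ≠ 0 := by
    rintro rfl
    refine hB ?_
    rw [zpow_zero, mul_one]
    exact isAlgebraic_algebraMap c
  obtain ⟨c', hc', hr⟩ := exists_riter_C_mul_X_zpow hc hk l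
  have hke : k ^ l = e := by
    have h1 := congrArg RatFunc.intDegree (hr.symm.trans h)
    have h2 := intDegree_C_mul_X_zpow one_ne_zero e
    rw [map_one, one_mul] at h2
    rwa [intDegree_C_mul_X_zpow hc', h2] at h1
  have hkd : k.natAbs = d := by
    rw [← hke, Int.natAbs_pow] at he
    exact Nat.pow_left_injective (by omega) he
  have hconj := conjugate_C_mul_X_zpow hc hk (by omega)
  rcases Int.natAbs_eq k with h1 | h1 <;> rw [hkd] at h1
  · left
    convert! hconj
    rw [h1, zpow_natCast]
  · right
    convert! hconj
    rw [h1, zpow_neg, zpow_natCast]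

/-! ### The derivative of a rational function -/

/-- The formal derivative of a rational function. -/
def rderiv (f : RatFunc ℂ) : RatFunc ℂ :=
  algebraMap ℂ[X] (RatFunc ℂ) (derivative f.num * f.denom - f.num * derivative f.denom) /
    algebraMap ℂ[X] (RatFunc ℂ) f.denom ^ 2

lemma rderiv_eq_of_eq_div {f : RatFunc ℂ} {p q : ℂ[X]} (hq : q ≠ 0)
    (hf : f = algebraMap ℂ[X] (RatFunc ℂ) p / algebraMap ℂ[X] (RatFunc ℂ) q) :
    rderiv f = algebraMap ℂ[X] (RatFunc ℂ) (derivative p * q - p * derivative q) /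
      algebraMap ℂ[X] (RatFunc ℂ) q ^ 2 := by
  have hinj := RatFunc.algebraMap_injective ℂ
  have hq' : algebraMap ℂ[X] (RatFunc ℂ) q ≠ 0 := by simpa using hq
  have hd' : algebraMap ℂ[X] (RatFunc ℂ) f.denom ≠ 0 := by simpa using f.denom_ne_zero
  have h : f.num * q = p * f.denom := by
    apply hinj
    rw [map_mul, map_mul, ← div_eq_div_iff hd' hq', RatFunc.num_div_denom, hf]
  have hd := congrArg derivative h
  rw [derivative_mul, derivative_mul] at hd
  have hpoly : (derivative f.num * f.denom - f.num * derivative f.denom) * q ^ 2 =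
      (derivative p * q - p * derivative q) * f.denom ^ 2 := by
    linear_combination f.denom * q * hd - (derivative f.denom * q + f.denom * derivative q) * h
  rw [rderiv, div_eq_div_iff (pow_ne_zero _ hd') (pow_ne_zero _ hq'), ← map_pow, ← map_pow,
    ← map_mul, ← map_mul, hpoly]

lemma rderiv_div (p : ℂ[X]) {q : ℂ[X]} (hq : q ≠ 0) :
    rderiv (algebraMap ℂ[X] (RatFunc ℂ) p / algebraMap ℂ[X] (RatFunc ℂ) q) =
      algebraMap ℂ[X] (RatFunc ℂ) (derivative p * q - p * derivative q) /
        algebraMap ℂ[X] (RatFunc ℂ) q ^ 2 :=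
  rderiv_eq_of_eq_div hq rfl

lemma exists_div_div (f g : RatFunc ℂ) : ∃ p q r : ℂ[X], r ≠ 0 ∧
    f = algebraMap ℂ[X] (RatFunc ℂ) p / algebraMap ℂ[X] (RatFunc ℂ) r ∧
    g = algebraMap ℂ[X] (RatFunc ℂ) q / algebraMap ℂ[X] (RatFunc ℂ) r := by
  have hf : algebraMap ℂ[X] (RatFunc ℂ) f.denom ≠ 0 := by simpa using f.denom_ne_zero
  have hg : algebraMap ℂ[X] (RatFunc ℂ) g.denom ≠ 0 := by simpa using g.denom_ne_zero
  refine ⟨f.num * g.denom, g.num * f.denom, f.denom * g.denom,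
    mul_ne_zero f.denom_ne_zero g.denom_ne_zero, ?_, ?_⟩
  · rw [map_mul, map_mul, mul_div_mul_right _ _ hg, RatFunc.num_div_denom]
  · rw [map_mul, map_mul, mul_comm (algebraMap _ _ f.denom), mul_div_mul_right _ _ hf,
      RatFunc.num_div_denom]

lemma rderiv_add (f g : RatFunc ℂ) : rderiv (f + g) = rderiv f + rderiv g := by
  obtain ⟨p, q, r, hr, rfl, rfl⟩ := exists_div_div f g
  rw [← add_div, ← map_add, rderiv_div _ hr, rderiv_div _ hr, rderiv_div _ hr, ← add_div,
    ← map_add, derivative_add]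
  congr 2
  ring

lemma rderiv_mul (f g : RatFunc ℂ) : rderiv (f * g) = f * rderiv g + g * rderiv f := by
  obtain ⟨p, q, r, hr, rfl, rfl⟩ := exists_div_div f g
  have hr' : algebraMap ℂ[X] (RatFunc ℂ) r ≠ 0 := by simpa using hr
  rw [div_mul_div_comm, ← map_mul, ← map_mul, rderiv_div _ (mul_ne_zero hr hr),
    rderiv_div _ hr, rderiv_div _ hr]
  simp only [derivative_mul, map_mul, map_sub, map_add]
  field_simp
  ring

lemma rderiv_algebraMap (p : ℂ[X]) :
    rderiv (algebraMap ℂ[X] (RatFunc ℂ) p) = algebraMap ℂ[X] (RatFunc ℂ) (derivative p) := by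
  simpa using rderiv_div p one_ne_zero

lemma rderiv_aeval (p : ℂ[X]) (f : RatFunc ℂ) :
    rderiv (Polynomial.aeval f p) = Polynomial.aeval f (derivative p) * rderiv f := by
  have hC (c : ℂ) : rderiv (algebraMap ℂ (RatFunc ℂ) c) = 0 := by
    rw [IsScalarTower.algebraMap_apply ℂ ℂ[X] (RatFunc ℂ), rderiv_algebraMap]
    simp
  induction p using Polynomial.induction_on with
  | C a => rw [aeval_C, hC, derivative_C, map_zero, zero_mul]
  | add p q hp hq => rw [map_add, rderiv_add, hp, hq, derivative_add, map_add, add_mul]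
  | monomial n a ih =>
    rw [pow_succ, ← mul_assoc, map_mul, rderiv_mul, ih,
      derivative_mul (f := Polynomial.C a * X ^ n), map_add, map_mul _ _ X,
      map_mul _ _ (derivative X), aeval_X, derivative_X, map_one]
    ring

/-! ### Rational functions commuting with Chebyshev polynomials -/

lemma one_sub_X_sq_mul_derivative_T_sq (n : ℤ) :
    (1 - X ^ 2) * derivative (Chebyshev.T ℂ n) ^ 2 =
      Polynomial.C ((n : ℂ) ^ 2) * (1 - Chebyshev.T ℂ n ^ 2) := by
  set T := Chebyshev.T ℂ n with hTdef
  have hT : (1 - X ^ 2) * derivative (derivative T) = X * derivative T - (n ^ 2 : ℂ[X]) * T :=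
    Chebyshev.one_sub_X_sq_mul_derivative_derivative_T_eq_poly_in_T (R := ℂ) n
  have hn : Polynomial.C ((n : ℂ) ^ 2) = (n : ℂ[X]) ^ 2 := by simp
  have hd : derivative ((1 - X ^ 2) * derivative T ^ 2 + Polynomial.C ((n : ℂ) ^ 2) * T ^ 2) =
      0 := by
    simp only [sq, derivative_add, derivative_mul, derivative_sub, derivative_one, derivative_X,
      derivative_C] at hn ⊢
    rw [hn]
    linear_combination 2 * derivative T * hT
  have hc := eq_C_of_derivative_eq_zero hd
  have h1 := congrArg (eval 1) hc
  rw [eval_C] at h1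
  rw [← h1] at hc
  simp only [eval_add, eval_mul, eval_sub, eval_pow, eval_one, eval_X, eval_C, hTdef,
    Chebyshev.T_eval_one] at hc
  rw [← hTdef] at hc
  norm_num at hc ⊢
  linear_combination hc

lemma eq_natDegree_sq_of_chebyshev_ode {p : ℂ[X]} (hp : p ≠ 0) {c : ℂ}
    (h : (1 - X ^ 2) * derivative (derivative p) - X * derivative p = -(Polynomial.C c * p)) :
    c = (p.natDegree : ℂ) ^ 2 := by
  have h1 := congrArg (fun q => q.coeff p.natDegree) h
  have h2 : p.coeff (p.natDegree + 2) = 0 := coeff_eq_zero_of_natDegree_lt (by omega)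
  have hX (q : ℂ[X]) (i : ℕ) : (X * derivative q).coeff i = i * q.coeff i := by
    cases i with
    | zero => simp
    | succ i => rw [coeff_X_mul, coeff_derivative]; push_cast; ring
  have hXX : X ^ 2 * derivative (derivative p) =
      X * derivative (X * derivative p) - X * derivative p := by
    rw [derivative_mul, derivative_X]
    ring
  rw [sub_mul, one_mul, hXX] at h1
  simp only [coeff_sub, hX, coeff_neg, coeff_C_mul, coeff_derivative, add_assoc] at h1
  norm_num [h2, coeff_natDegree] at h1
  refine mul_right_cancel₀ (leadingCoeff_ne_zero.mpr hp) ?_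
  linear_combination -h1

/-- Nonconstant polynomial solutions of `(1 - X²) p'² = c (1 - p²)` are Chebyshev polynomials
up to sign. -/
lemma eq_T_or_eq_neg_T_of_ode {a : ℂ[X]} (ha : derivative a ≠ 0) {c : ℂ}
    (h : (1 - X ^ 2) * derivative a ^ 2 = Polynomial.C c * (1 - a ^ 2)) :
    a = Chebyshev.T ℂ a.natDegree ∨ a = -Chebyshev.T ℂ a.natDegree := by
  have ha0 : a ≠ 0 := by
    rintro rfl
    simp at ha
  have hdeg : a.natDegree ≠ 0 := fun h0 => ha (derivative_of_natDegree_zero h0)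
  have hode : (1 - X ^ 2) * derivative (derivative a) - X * derivative a =
      -(Polynomial.C c * a) := by
    have hd := congrArg derivative h
    simp only [derivative_mul, derivative_sub, derivative_one, derivative_pow, derivative_X,
      derivative_C] at hd
    norm_num [show Polynomial.C (2 : ℂ) = 2 from rfl] at hd
    apply mul_left_cancel₀ (mul_ne_zero (two_ne_zero (α := ℂ[X])) ha)
    linear_combination hd
  obtain rfl := eq_natDegree_sq_of_chebyshev_ode ha0 hode
  have hT := Chebyshev.one_sub_X_sq_mul_derivative_derivative_T_eq_poly_in_T (R := ℂ) a.natDegree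
  set T := Chebyshev.T ℂ a.natDegree with hTdef
  have hTdeg : T.natDegree = a.natDegree := by rw [hTdef, Chebyshev.natDegree_T]; simp
  have hT0 : T ≠ 0 := by
    intro h0
    rw [h0, natDegree_zero] at hTdeg
    exact hdeg hTdeg.symm
  have hTlc := leadingCoeff_ne_zero.mpr hT0
  set w := a.leadingCoeff / T.leadingCoeff with hw
  have hw0 : w ≠ 0 := div_ne_zero (leadingCoeff_ne_zero.mpr ha0) hTlc
  have haw : a = Polynomial.C w * T := by
    refine sub_eq_zero.mp ?_
    by_contra hne
    have hdeq : (Polynomial.C w * T).degree = a.degree := by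
      rw [degree_C_mul hw0, degree_eq_natDegree hT0, degree_eq_natDegree ha0, hTdeg]
    have hlt := degree_sub_lt_left hdeq.symm ha0 (by
      rw [leadingCoeff_mul, leadingCoeff_C, hw, div_mul_cancel₀ _ hTlc])
    have h1 := eq_natDegree_sq_of_chebyshev_ode (c := (a.natDegree : ℂ) ^ 2) hne (by
      simp only [Function.iterate_succ, Function.iterate_zero, Function.comp_apply, id] at hT
      simp only [derivative_sub, derivative_C_mul]
      simp only [map_pow, map_natCast] at hode ⊢
      push_cast at hT
      linear_combination hode - Polynomial.C w * hT)
    rw [degree_eq_natDegree hne, degree_eq_natDegree ha0, Nat.cast_lt] at hlt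
    have h2 : a.natDegree ^ 2 = (a - Polynomial.C w * T).natDegree ^ 2 := by exact_mod_cast h1
    exact hlt.ne' (Nat.pow_left_injective two_ne_zero h2)
  have h1 := congrArg (eval 1) h
  have ha1 : a.eval 1 = w := by
    rw [haw, eval_mul, eval_C, hTdef, Chebyshev.T_eval_one, mul_one]
  simp only [eval_mul, eval_sub, eval_pow, eval_one, eval_X, eval_C, ha1] at h1
  have hdeg' : (a.natDegree : ℂ) ^ 2 ≠ 0 := by exact_mod_cast pow_ne_zero 2 hdeg
  have hw1 : w ^ 2 = 1 := by
    have := (mul_eq_zero.mp (h1.symm.trans (by ring))).resolve_left hdeg'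
    linear_combination -this
  rcases sq_eq_one_iff.mp hw1 with h2 | h2
  · exact .inl (haw.trans (by rw [h2, Polynomial.C_1, one_mul]))
  · exact .inr (haw.trans (by simp [h2]))

/-- The denominator of a rational solution of `(1 - X²) B'² = c (1 - B²)` is constant. -/
lemma eq_one_of_ode {a b : ℂ[X]} (hb : b.Monic) (hab : IsCoprime a b)
    (h : b ^ 2 ∣ (1 - X ^ 2) * (derivative a * b - a * derivative b) ^ 2) : b = 1 := by
  by_contra hne
  have hdeg : b.degree ≠ 0 := fun h0 => hne (hb.natDegree_eq_zero.mp
    (natDegree_eq_of_degree_eq_some h0))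
  obtain ⟨r, hr⟩ := IsAlgClosed.exists_root b hdeg
  obtain ⟨β, hβ, hβr⟩ := exists_eq_pow_rootMultiplicity_mul_and_not_dvd b hb.ne_zero r
  have hm := (rootMultiplicity_pos hb.ne_zero).mpr hr
  obtain ⟨m, hm'⟩ : ∃ m, rootMultiplicity r b = m + 1 := ⟨rootMultiplicity r b - 1, by omega⟩
  rw [hm'] at hβ
  rw [dvd_iff_isRoot, IsRoot.def] at hβr
  have har : a.eval r ≠ 0 := fun h0 => by
    obtain ⟨u, v, huv⟩ := hab
    have := congrArg (eval r) huv
    simp [h0, hr.eq_zero] at this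
  set V := (X - Polynomial.C r) * (derivative a * β - a * derivative β) -
    Polynomial.C ((m : ℂ) + 1) * a * β with hV
  have hW : derivative a * b - a * derivative b = (X - Polynomial.C r) ^ m * V := by
    rw [hβ, hV]
    simp only [derivative_mul, derivative_X_sub_C_pow, Nat.add_sub_cancel]
    push_cast
    ring
  have hVr : V.eval r ≠ 0 := by
    have : (m : ℂ) + 1 ≠ 0 := by exact_mod_cast Nat.succ_ne_zero m
    simp [hV, har, hβr, this]
  have hX0 : (X - Polynomial.C r) ^ (2 * m) ≠ 0 := pow_ne_zero _ (X_sub_C_ne_zero r)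
  have h2 : (X - Polynomial.C r) ^ 2 ∣ (1 - X ^ 2) * V ^ 2 := by
    obtain ⟨g, hg⟩ := h
    refine ⟨β ^ 2 * g, mul_left_cancel₀ hX0 ?_⟩
    rw [hW, hβ] at hg
    linear_combination hg
  have hcop : IsCoprime ((X - Polynomial.C r) ^ 2) (V ^ 2) := by
    refine IsCoprime.pow ((irreducible_X_sub_C r).coprime_iff_not_dvd.mpr ?_)
    rwa [dvd_iff_isRoot]
  obtain ⟨g, hg⟩ := hcop.dvd_of_dvd_mul_right h2
  have e1 := congrArg (eval r) hg
  have e2 := congrArg (eval r) (congrArg derivative hg)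
  simp [derivative_pow] at e1 e2
  simp [e2] at e1

lemma div_sq_identity {K : Type*} [Field K] {a b W a₁ b₁ W₁ x t t' s n : K}
    (hb : b ≠ 0) (hb₁ : b₁ ≠ 0) (hn : n ≠ 0)
    (hd : W₁ * t' / b₁ ^ 2 = s * (W / b ^ 2))
    (ht : (1 - x ^ 2) * t' ^ 2 = n * (1 - t ^ 2))
    (hs : (1 - (a / b) ^ 2) * s ^ 2 = n * (1 - (a₁ / b₁) ^ 2)) :
    (1 - t ^ 2) * W₁ ^ 2 * (b ^ 2 * (b ^ 2 - a ^ 2)) =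
      b₁ ^ 2 * (b₁ ^ 2 - a₁ ^ 2) * ((1 - x ^ 2) * W ^ 2) := by
  have hd' : W₁ * t' * b ^ 2 = s * W * b₁ ^ 2 := by
    field_simp at hd
    linear_combination hd
  have hs' : (b ^ 2 - a ^ 2) * s ^ 2 * b₁ ^ 2 = n * (b₁ ^ 2 - a₁ ^ 2) * b ^ 2 := by
    field_simp at hs
    linear_combination hs
  apply mul_left_cancel₀ hn
  apply mul_left_cancel₀ (pow_ne_zero 2 hb)
  linear_combination -W₁ ^ 2 * b ^ 4 * (b ^ 2 - a ^ 2) * ht + (1 - x ^ 2) * (b ^ 2 - a ^ 2) *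
    (W₁ * t' * b ^ 2 + s * W * b₁ ^ 2) * hd' + (1 - x ^ 2) * W ^ 2 * b₁ ^ 2 * hs'

lemma exists_eq_T_of_comm {B : RatFunc ℂ} (hB : Transcendental ℂ B) {P : ℂ[X]}
    (hP : 2 ≤ P.natDegree)
    (hode : (1 - X ^ 2) * derivative P ^ 2 =
      Polynomial.C ((P.natDegree : ℂ) ^ 2) * (1 - P ^ 2))
    (h : rcomp B (algebraMap ℂ[X] (RatFunc ℂ) P) = Polynomial.aeval B P) :
    ∃ k : ℕ, B = chebyRF k ∨ B = -chebyRF k := by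
  have hinj := RatFunc.algebraMap_injective ℂ
  have hb0 := B.denom_ne_zero
  have hbm := B.monic_denom
  have hbP0 : B.denom.comp P ≠ 0 := comp_ne_zero_of_natDegree_ne_zero hb0 (by omega)
  have hb' : algebraMap ℂ[X] (RatFunc ℂ) B.denom ≠ 0 := by simpa using hb0
  have hbP' : algebraMap ℂ[X] (RatFunc ℂ) (B.denom.comp P) ≠ 0 := by simpa using hbP0
  rw [rcomp, aeval_algebraMap_ratFunc, aeval_algebraMap_ratFunc] at h
  set W := derivative B.num * B.denom - B.num * derivative B.denom with hW
  have hd := congrArg rderiv h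
  rw [rderiv_div _ hbP0, rderiv_aeval] at hd
  have hWP : derivative (B.num.comp P) * B.denom.comp P -
      B.num.comp P * derivative (B.denom.comp P) = W.comp P * derivative P := by
    simp only [hW, derivative_comp, sub_comp, mul_comp]
    ring
  have hn : algebraMap ℂ[X] (RatFunc ℂ) (Polynomial.C ((P.natDegree : ℂ) ^ 2)) ≠ 0 := by
    have : P.natDegree ≠ 0 := by omega
    simpa using this
  have hs := congrArg (Polynomial.aeval B) hode
  simp only [map_mul, map_sub, map_one, map_pow (Polynomial.aeval B), aeval_X, aeval_C,
    ← h] at hs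
  have ht := congrArg (algebraMap ℂ[X] (RatFunc ℂ)) hode
  simp only [map_mul, map_sub, map_one, map_pow (algebraMap ℂ[X] (RatFunc ℂ))] at ht
  rw [IsScalarTower.algebraMap_apply ℂ ℂ[X] (RatFunc ℂ), algebraMap_eq] at hs
  rw [hWP, map_mul, rderiv, ← hW] at hd
  nth_rewrite 1 [← RatFunc.num_div_denom B] at hs
  have key := div_sq_identity hb' hbP' hn hd ht hs
  simp only [← map_pow, ← map_mul, ← map_sub, ← map_one (algebraMap ℂ[X] (RatFunc ℂ))] at key
  have key := hinj key
  have hp0 : B.denom ^ 2 * (B.denom ^ 2 - B.num ^ 2) ≠ 0 := by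
    refine mul_ne_zero (pow_ne_zero _ hb0) fun h0 => hB ?_
    have h1 : B ^ 2 = 1 := by
      rw [← RatFunc.num_div_denom B, div_pow, div_eq_one_iff_eq (pow_ne_zero _ hb'), ← map_pow,
        ← map_pow, sub_eq_zero.mp h0]
    rcases sq_eq_one_iff.mp h1 with h2 | h2
    · rw [h2]; exact isAlgebraic_one
    · rw [h2]; exact isAlgebraic_one.neg
  obtain ⟨c, hc⟩ := exists_eq_C_mul_of_comp_mul_eq (q := (1 - X ^ 2) * W ^ 2) hP hp0 (by
    simpa only [mul_comp, sub_comp, pow_comp, one_comp, X_comp] using key)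
  have hb1 : B.denom = 1 := eq_one_of_ode hbm B.isCoprime_num_denom
    ⟨Polynomial.C c * (B.denom ^ 2 - B.num ^ 2), by rw [← hW, hc]; ring⟩
  rw [hW, hb1] at hc
  have hBnum : B = algebraMap ℂ[X] (RatFunc ℂ) B.num := by
    conv_lhs => rw [← RatFunc.num_div_denom B, hb1, map_one, div_one]
  have hder : derivative B.num ≠ 0 := fun h0 => hB (by
    rw [hBnum, eq_C_of_derivative_eq_zero h0, algebraMap_C_ratFunc]
    exact isAlgebraic_algebraMap _)
  refine ⟨B.num.natDegree, ?_⟩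
  rcases eq_T_or_eq_neg_T_of_ode hder (c := c) (by simpa using hc) with h1 | h1
  · left; rw [chebyRF, ← h1, ← hBnum]
  · right; rw [chebyRF, ← map_neg, ← h1, ← hBnum]

lemma riter_algebraMap (p : ℂ[X]) (l : ℕ) :
    riter (algebraMap ℂ[X] (RatFunc ℂ) p) l = algebraMap ℂ[X] (RatFunc ℂ) (p.comp^[l] X) := by
  induction l with
  | zero => simp [riter]
  | succ l ih =>
    rw [riter, ih, rcomp_algebraMap, aeval_algebraMap_ratFunc, Function.iterate_succ_apply']

lemma conjugate_self (B : RatFunc ℂ) : Conjugate B B :=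
  ⟨RatFunc.X, RatFunc.X, rcomp_X_left _, rcomp_X_left _, by rw [rcomp_X_left, rcomp_X_right]⟩

lemma natDegree_eq_of_riter_eq {p q : ℂ[X]} {d l : ℕ} (hl : 1 ≤ l) (hq : q.natDegree = d ^ l)
    (h : riter (algebraMap ℂ[X] (RatFunc ℂ) p) l = algebraMap ℂ[X] (RatFunc ℂ) q) :
    p.natDegree = d := by
  rw [riter_algebraMap] at h
  have h1 := congrArg natDegree (RatFunc.algebraMap_injective ℂ h)
  rw [natDegree_iterate_comp, natDegree_X, mul_one, hq] at h1
  exact Nat.pow_left_injective (by omega) h1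

lemma conjugate_of_riter_eq_cheby {B : RatFunc ℂ} (hB : Transcendental ℂ B) {d l : ℕ}
    (hd : 2 ≤ d) (hl : 1 ≤ l)
    (h : riter B l = chebyRF (d ^ l) ∨ riter B l = -chebyRF (d ^ l)) :
    Conjugate B (chebyRF d) ∨ Conjugate B (-chebyRF d) := by
  have hdl : 2 ≤ d ^ l := hd.trans (Nat.le_self_pow (by omega) d)
  obtain ⟨P, hP, hPT⟩ : ∃ P : ℂ[X], riter B l = algebraMap ℂ[X] (RatFunc ℂ) P ∧
      (P = Chebyshev.T ℂ (d ^ l : ℕ) ∨ P = -Chebyshev.T ℂ (d ^ l : ℕ)) := by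
    rcases h with h | h
    · exact ⟨_, h, .inl rfl⟩
    · exact ⟨_, by rw [h, chebyRF, ← map_neg], .inr rfl⟩
  have hdeg : P.natDegree = d ^ l := by
    rcases hPT with rfl | rfl
    · rw [Chebyshev.natDegree_T, Int.natAbs_natCast]
    · rw [natDegree_neg, Chebyshev.natDegree_T, Int.natAbs_natCast]
  have hode : (1 - X ^ 2) * derivative P ^ 2 =
      Polynomial.C ((P.natDegree : ℂ) ^ 2) * (1 - P ^ 2) := by
    have := one_sub_X_sq_mul_derivative_T_sq (d ^ l : ℕ)
    rw [Int.cast_natCast] at this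
    rw [hdeg]
    rcases hPT with rfl | rfl
    · exact this
    · rw [derivative_neg, neg_sq, neg_sq, this]
  obtain ⟨k, hk⟩ := exists_eq_T_of_comm hB (by omega) hode (by
    rw [← hP, rcomp_riter_comm hB, hP, rcomp_algebraMap])
  rcases hk with rfl | rfl
  · have h1 := natDegree_eq_of_riter_eq hl hdeg hP
    rw [Chebyshev.natDegree_T, Int.natAbs_natCast] at h1
    exact .inl (h1 ▸ conjugate_self _)
  · rw [chebyRF, ← map_neg] at hP
    have h1 := natDegree_eq_of_riter_eq hl hdeg hP
    rw [natDegree_neg, Chebyshev.natDegree_T, Int.natAbs_natCast] at h1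
    exact .inr (h1 ▸ conjugate_self _)

/-- **Lemma (iterates conjugate to power or Chebyshev maps).** If `A^{∘l}` is conjugate
to `z^{d^l}` or `z^{-d^l}`, then `A` is conjugate to `z^d` or `z^{-d}`; if `A^{∘l}` is
conjugate to `T_{d^l}` or `-T_{d^l}`, then `A` is conjugate to `T_d` or `-T_d`. -/
theorem iterate_conjugate (A : RatFunc ℂ) (d : ℕ) (hd : 2 ≤ d) (hdeg : rdeg A = d)
    (l : ℕ) (hl : 1 ≤ l) :
    ((Conjugate (riter A l) (RatFunc.X ^ (d ^ l)) ∨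
        Conjugate (riter A l) ((RatFunc.X ^ (d ^ l))⁻¹)) →
      (Conjugate A (RatFunc.X ^ d) ∨ Conjugate A ((RatFunc.X ^ d)⁻¹))) ∧
    ((Conjugate (riter A l) (chebyRF (d ^ l)) ∨
        Conjugate (riter A l) (-(chebyRF (d ^ l)))) →
      (Conjugate A (chebyRF d) ∨ Conjugate A (-(chebyRF d)))) := by
  have hA : Transcendental ℂ A := transcendental_of_rdeg_ne_zero (by omega)
  refine ⟨?_, ?_⟩
  · rintro (h | h)
    · obtain ⟨B, hB, hr, hconj⟩ := h.exists_riter_eq hA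
      exact (conjugate_of_riter_eq_X_zpow hB hd hl (e := (d ^ l : ℕ)) (Int.natAbs_natCast _)
        (by rw [hr, zpow_natCast])).imp (hconj _) (hconj _)
    · obtain ⟨B, hB, hr, hconj⟩ := h.exists_riter_eq hA
      exact (conjugate_of_riter_eq_X_zpow hB hd hl (e := -(d ^ l : ℕ))
        (by rw [Int.natAbs_neg, Int.natAbs_natCast])
        (by rw [hr, zpow_neg, zpow_natCast])).imp (hconj _) (hconj _)
  · rintro (h | h)
    · obtain ⟨B, hB, hr, hconj⟩ := h.exists_riter_eq hA
      exact (conjugate_of_riter_eq_cheby hB hd hl (.inl hr)).imp (hconj _) (hconj _)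
    · obtain ⟨B, hB, hr, hconj⟩ := h.exists_riter_eq hA
      exact (conjugate_of_riter_eq_cheby hB hd hl (.inr hr)).imp (hconj _) (hconj _)

end GenLattes
end
end
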